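/- arXiv:2009.10889 — 2 statements merged into one kernel-verified Lean document; each statement's English description precedes it below -/
import Mathlib

section
/- Let p be a prime, d ≥ 1, q = p^d, n ≥ 1, and let K be an algebraically closed field with char K ≠ p. Let A be a finite commutative local ring whose maximal ideal m satisfies m² = 0, |A/m| = q, and |A| = q². Let G = GL_n(A), let ρ : GL_n(A) → GL_n(A/m) be the homomorphism induced by reduction modulo m, and let N = ker ρ. Let χ : N →* Kˣ be a group homomorphism, and let H = {g ∈ G : ∀ x ∈ N, χ(g·x·g⁻¹) = χ(x)} be the stabilizer of χ in G. Then there exists a group homomorphism χ̃ : H →* Kˣ whose restriction to N equals χ. -/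
open Matrix

/-- The stabilizer (inertia) subgroup in `G` of a character `χ : N → Kˣ` of a normal
subgroup `N`, for the conjugation action of `G` on characters of `N`. -/
def charStabilizer {G : Type*} [Group G] {K : Type*} [Field K]
    (N : Subgroup G) [hN : N.Normal] (χ : N →* Kˣ) : Subgroup G where
  carrier := {g | ∀ (x : G) (hx : x ∈ N), χ ⟨g * x * g⁻¹, hN.conj_mem x hx g⟩ = χ ⟨x, hx⟩}
  one_mem' := by
    intro x hx
    exact congrArg χ (Subtype.ext (by group))
  mul_mem' := by
    intro a b ha hb x hx
    have hbx : b * x * b⁻¹ ∈ N := hN.conj_mem x hx b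
    have h1 := ha (b * x * b⁻¹) hbx
    have h2 := hb x hx
    have h3 : (⟨(a * b) * x * (a * b)⁻¹, hN.conj_mem x hx (a * b)⟩ : N) =
        ⟨a * (b * x * b⁻¹) * a⁻¹, hN.conj_mem _ hbx a⟩ := Subtype.ext (by group)
    exact (congrArg χ h3).trans (h1.trans h2)
  inv_mem' := by
    intro a ha x hx
    have hy : a⁻¹ * x * (a⁻¹)⁻¹ ∈ N := hN.conj_mem x hx a⁻¹
    have h1 := ha (a⁻¹ * x * (a⁻¹)⁻¹) hy
    have h3 : (⟨a * (a⁻¹ * x * (a⁻¹)⁻¹) * a⁻¹, hN.conj_mem _ hy a⟩ : N) =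
        ⟨x, hx⟩ := Subtype.ext (by group)
    exact h1.symm.trans (congrArg χ h3)

section GroupTheory

variable {G M : Type*} [Group G] [CommGroup M]

/-- A `G`-invariant character of a normal subgroup `N` extends to `G` as soon as it is trivial on
`U ⊓ N` for some supplement `U` of `N`. -/
theorem exists_extension_of_supplement (N U : Subgroup G) [hN : N.Normal] (χ : N →* M)
    (hinv : ∀ (g x : G) (hx : x ∈ N), χ ⟨g * x * g⁻¹, hN.conj_mem x hx g⟩ = χ ⟨x, hx⟩)
    (hUN : ∀ g : G, ∃ u ∈ U, u⁻¹ * g ∈ N)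
    (htriv : ∀ (x : G) (hx : x ∈ N), x ∈ U → χ ⟨x, hx⟩ = 1) :
    ∃ θ : G →* M, ∀ x : N, θ x = χ x := by
  choose u huU huN using hUN
  have key : ∀ (g v : G) (_ : v ∈ U) (h : v⁻¹ * g ∈ N), χ ⟨_, huN g⟩ = χ ⟨_, h⟩ := by
    intro g v hv h
    have hmem : (u g)⁻¹ * v ∈ N := by
      have := N.mul_mem (huN g) (N.inv_mem h)
      rwa [show (u g)⁻¹ * g * (v⁻¹ * g)⁻¹ = (u g)⁻¹ * v by group] at this
    have hone := htriv _ hmem (U.mul_mem (U.inv_mem (huU g)) hv)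
    rw [show (⟨_, huN g⟩ : N) = ⟨_, hmem⟩ * ⟨_, h⟩ from Subtype.ext (by simp [mul_assoc]),
      map_mul, hone, one_mul]
  refine ⟨MonoidHom.mk' (fun g => χ ⟨_, huN g⟩) fun a b => ?_, fun x => ?_⟩
  · have hconj : (u b)⁻¹ * ((u a)⁻¹ * a) * u b ∈ N := by
      simpa using hN.conj_mem _ (huN a) (u b)⁻¹
    have hab : (u a * u b)⁻¹ * (a * b) ∈ N := by
      have := N.mul_mem hconj (huN b)
      rwa [show (u b)⁻¹ * ((u a)⁻¹ * a) * u b * ((u b)⁻¹ * b) = (u a * u b)⁻¹ * (a * b) by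
        group] at this
    have hχ : χ ⟨_, hconj⟩ = χ ⟨_, huN a⟩ := by
      rw [← hinv (u b)⁻¹ _ (huN a)]
      congr 2
      simp
    rw [key (a * b) (u a * u b) (U.mul_mem (huU a) (huU b)) hab,
      show (⟨_, hab⟩ : N) = ⟨_, hconj⟩ * ⟨_, huN b⟩ from Subtype.ext (by simp; group),
      map_mul, hχ]
  · change χ _ = χ x
    rw [key x 1 U.one_mem (by simp)]
    congr 1
    exact Subtype.ext (by simp)

/-- A `G`-invariant character of a normal subgroup `N` extends to `G` as soon as it extends to a
subgroup of index prime to the order of `N`. -/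
theorem exists_extension_of_coprime_index [Finite G] (N P : Subgroup G) [hN : N.Normal]
    (hNP : N ≤ P) (hcop : P.index.Coprime (Nat.card N)) (χ : N →* M)
    (hinv : ∀ (g x : G) (hx : x ∈ N), χ ⟨g * x * g⁻¹, hN.conj_mem x hx g⟩ = χ ⟨x, hx⟩)
    (θ : P →* M) (hθ : ∀ (x : G) (hx : x ∈ N), θ ⟨x, hNP hx⟩ = χ ⟨x, hx⟩) :
    ∃ θ' : G →* M, ∀ x : N, θ' x = χ x := by
  have htransfer : ∀ (x : G) (hx : x ∈ N), θ.transfer x = χ ⟨x, hx⟩ ^ P.index := by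
    intro x hx
    rw [MonoidHom.transfer_def θ default x, Subgroup.leftTransversals.diff]
    let _ := P.fintypeQuotientOfFiniteIndex
    rw [Subgroup.index, Nat.card_eq_fintype_card, ← Finset.card_univ]
    refine Finset.prod_eq_pow_card fun q _ => ?_
    have hq : x⁻¹ • q = q := by
      induction q using QuotientGroup.induction_on with
      | H g =>
        refine (QuotientGroup.eq.mpr ?_ : ((x⁻¹ * g : G) : G ⧸ P) = g)
        exact hNP (by simpa [mul_assoc] using hN.conj_mem x hx g⁻¹)
    set t : G := ((default : P.LeftTransversal).2.leftQuotientEquiv q : G) with ht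
    have hconj : t⁻¹ * x * t ∈ N := by simpa using hN.conj_mem x hx t⁻¹
    have hval : t⁻¹ * ((x • (default : P.LeftTransversal)).2.leftQuotientEquiv q : G) =
        t⁻¹ * x * t := by
      rw [Subgroup.smul_apply_eq_smul_apply_inv_smul, hq, smul_eq_mul, mul_assoc]
    calc _ = θ ⟨_, hNP hconj⟩ := congrArg θ (Subtype.ext hval)
      _ = χ ⟨_, hx⟩ := by
        rw [hθ _ hconj, ← hinv t⁻¹ x hx]
        congr 2
        simp
  refine ⟨(zpowGroupHom (P.index.gcdA (Nat.card N))).comp θ.transfer, fun x => ?_⟩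
  have hbezout := Nat.gcd_eq_gcd_ab P.index (Nat.card N)
  rw [hcop.gcd_eq_one, Nat.cast_one] at hbezout
  have hcard : χ x ^ (Nat.card N : ℤ) = 1 := by
    rw [zpow_natCast, ← map_pow, pow_card_eq_one', map_one]
  calc θ.transfer x ^ P.index.gcdA (Nat.card N)
      = χ x ^ ((P.index : ℤ) * P.index.gcdA (Nat.card N)) := by
        rw [htransfer x x.2, _root_.zpow_mul, zpow_natCast]
    _ = χ x ^ ((1 : ℤ) - Nat.card N * P.index.gcdB (Nat.card N)) := by
        rw [hbezout, add_sub_cancel_right]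
    _ = χ x := by rw [_root_.zpow_sub, _root_.zpow_mul, hcard, _root_.one_zpow, zpow_one, inv_one, mul_one]

end GroupTheory

/-- In a vector space, a chain of subspaces `W 0 ≥ W 1 ≥ ⋯ ≥ W r = 0` has an adapted basis. -/
theorem exists_linearIndepOn_span_eq {k V : Type*} [Field k] [AddCommGroup V] [Module k V]
    (r : ℕ) (W : ℕ → Submodule k V) (hW : Antitone W) (hr : W r = ⊥) :
    ∃ (b : Set V) (β : V → ℕ), LinearIndepOn k id b ∧
      ∀ a, Submodule.span k {v ∈ b | a ≤ β v} = W a := by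
  classical
  induction r generalizing W with
  | zero =>
    refine ⟨∅, 0, linearIndepOn_empty k id, fun a => ?_⟩
    have : W a = ⊥ := le_bot_iff.mp ((hW a.zero_le).trans hr.le)
    simp [this]
  | succ r ih =>
    obtain ⟨b', β', hb', hspan⟩ := ih (fun a => W (a + 1)) (fun _ _ h => hW (by lia)) hr
    have hsub : b' ⊆ (W 0 : Set V) := fun v hv =>
      hW (Nat.zero_le 1) (by
        rw [← zero_add 1, ← hspan 0]
        exact Submodule.subset_span ⟨hv, Nat.zero_le _⟩)
    refine ⟨hb'.extend hsub, fun v => if v ∈ b' then β' v + 1 else 0,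
      hb'.linearIndepOn_extend hsub, fun a => ?_⟩
    cases a with
    | zero => simp [hb'.span_extend_eq_span hsub]
    | succ a =>
      rw [← hspan a]
      congr 1
      ext v
      have := fun h : v ∈ b' => hb'.subset_extend hsub h
      by_cases hv : v ∈ b' <;> simp [hv, this]

section Flag

variable {R V Γ : Type*} [CommRing R] [AddCommGroup V] [Module R V] [Group Γ]

/-- The descending filtration of a representation by the powers of the augmentation ideal. -/
def augmentationFlag (σ : Γ →* Module.End R V) : ℕ → Submodule R V
  | 0 => ⊤
  | a + 1 => Submodule.span R {v | ∃ g, ∃ w ∈ augmentationFlag σ a, v = σ g w - w}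

theorem augmentationFlag_antitone (σ : Γ →* Module.End R V) : Antitone (augmentationFlag σ) := by
  refine antitone_nat_of_succ_le fun a => ?_
  induction a with
  | zero => exact le_top
  | succ a ih =>
    refine Submodule.span_mono ?_
    rintro v ⟨g, w, hw, rfl⟩
    exact ⟨g, w, ih hw, rfl⟩

theorem exists_augmentationFlag_eq_bot {p : ℕ} [Fact p.Prime] [Finite Γ] [Finite V]
    (hΓ : IsPGroup p Γ) {e : ℕ} (hV : Nat.card V = p ^ e) (σ : Γ →* Module.End R V) :
    ∃ r, augmentationFlag σ r = ⊥ := by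
  let _ : DistribMulAction Γ V := DistribMulAction.compHom V σ
  let φ : Γ →* MulAut (Multiplicative V) :=
    (MulAutMultiplicative V).symm.toMonoidHom.comp (DistribMulAction.toAddAut Γ V)
  have hφ : ∀ g v, φ g (Multiplicative.ofAdd v) = Multiplicative.ofAdd (σ g v) := fun _ _ => rfl
  have : Finite (Multiplicative V ⋊[φ] Γ) := Finite.of_equiv _ SemidirectProduct.equivProd.symm
  obtain ⟨f, hf⟩ := IsPGroup.iff_card.mp hΓ
  have hp : IsPGroup p (Multiplicative V ⋊[φ] Γ) := IsPGroup.of_card (n := e + f) (by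
    rw [SemidirectProduct.card, hf, pow_add, ← hV]; rfl)
  obtain ⟨r, hr⟩ := Subgroup.nilpotent_iff_lowerCentralSeries.mp hp.isNilpotent
  have key : ∀ a, ∀ v ∈ augmentationFlag σ a,
      (SemidirectProduct.inl (Multiplicative.ofAdd v) : Multiplicative V ⋊[φ] Γ) ∈
        (⊤ : Subgroup (Multiplicative V ⋊[φ] Γ)).lowerCentralSeries a := by
    intro a
    induction a with
    | zero => intro v _; trivial
    | succ a ih =>
      intro v hv
      suffices ∀ c : R, (SemidirectProduct.inl (Multiplicative.ofAdd (c • v)) :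
          Multiplicative V ⋊[φ] Γ) ∈
            (⊤ : Subgroup (Multiplicative V ⋊[φ] Γ)).lowerCentralSeries (a + 1) by
        simpa using this 1
      induction hv using Submodule.span_induction with
      | mem v hv =>
        obtain ⟨g, w, hw, rfl⟩ := hv
        intro c
        have hcomm := Subgroup.commutator_mem_commutator
          (Subgroup.mem_top (SemidirectProduct.inr g : Multiplicative V ⋊[φ] Γ))
          (ih _ (Submodule.smul_mem _ c hw))
        rw [Subgroup.commutator_comm] at hcomm
        convert! hcomm using 1
        rw [commutatorElement_def, ← map_inv, ← SemidirectProduct.inl_aut, hφ, ← map_inv,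
          ← map_mul, ← ofAdd_neg, ← ofAdd_add, (σ g).map_smul, smul_sub, sub_eq_add_neg]
      | zero => simp
      | add v w _ _ hv hw =>
        intro c
        rw [smul_add, ofAdd_add, map_mul]
        exact Subgroup.mul_mem _ (hv c) (hw c)
      | smul d v _ hv =>
        intro c
        rw [smul_smul]
        exact hv _
  refine ⟨r, (Submodule.eq_bot_iff _).mpr fun v hv => ?_⟩
  have := key r v hv
  rw [hr, Subgroup.mem_bot, ← map_one SemidirectProduct.inl, SemidirectProduct.inl_inj] at this
  exact this

end Flag

theorem mul_apply_mem_left {A : Type*} [CommRing A] {n : ℕ} {I : Ideal A} (x : Matrix (Fin n) (Fin n) A)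
    {y : Matrix (Fin n) (Fin n) A} (hy : ∀ i j, y i j ∈ I) (i j : Fin n) : (x * y) i j ∈ I := by
  rw [Matrix.mul_apply]
  exact I.sum_mem fun l _ => I.mul_mem_left _ (hy l j)

theorem mul_apply_mem_right {A : Type*} [CommRing A] {n : ℕ} {I : Ideal A} {x : Matrix (Fin n) (Fin n) A}
    (y : Matrix (Fin n) (Fin n) A) (hx : ∀ i j, x i j ∈ I) (i j : Fin n) : (x * y) i j ∈ I := by
  rw [Matrix.mul_apply]
  exact I.sum_mem fun l _ => I.mul_mem_right _ (hx i l)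

section Character

open IsLocalRing

variable {A M Γ : Type*} [CommRing A] [IsLocalRing A] [CommGroup M] [Group Γ] {n : ℕ}

/-- The representation over the residue field obtained from a representation over a local ring. -/
noncomputable def residualRep (ι : Γ →* GL (Fin n) A) :
    Γ →* Module.End (ResidueField A) (Fin n → ResidueField A) :=
  (Matrix.toLinAlgEquiv' : Matrix (Fin n) (Fin n) (ResidueField A) ≃ₐ[ResidueField A] _)
    |>.toMonoidHom.comp <| (Units.coeHom _).comp <|
      (Matrix.GeneralLinearGroup.map (residue A)).comp ι

theorem residualRep_apply (ι : Γ →* GL (Fin n) A) (g : Γ) (w : Fin n → A) :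
    residualRep ι g (residue A ∘ w) = residue A ∘ ((ι g : Matrix (Fin n) (Fin n) A) *ᵥ w) := by
  ext i
  exact (RingHom.map_mulVec (residue A) _ w i).symm

theorem exists_lift_residue (v : Fin n → ResidueField A) : ∃ w : Fin n → A, residue A ∘ w = v :=
  residue_surjective.comp_left v

theorem smul_eq_smul_of_residue_eq (hm : ∀ s ∈ maximalIdeal A, ∀ t ∈ maximalIdeal A, s * t = 0)
    {t : A} (ht : t ∈ maximalIdeal A) {v w : Fin n → A} (h : residue A ∘ v = residue A ∘ w) :
    t • v = t • w := by
  ext i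
  have hi : v i - w i ∈ maximalIdeal A := by
    rw [← residue_eq_zero_iff, map_sub, sub_eq_zero]
    exact congrFun h i
  have := hm t ht _ hi
  rw [mul_sub, sub_eq_zero] at this
  exact this

/-- A `Γ`-invariant character of the additive group of matrices over the maximal ideal is trivial
on the matrices whose image lies in a step of the augmentation flag and whose kernel contains
that step. -/
theorem character_smul_vecMulVec_eq_one
    (hm : ∀ s ∈ maximalIdeal A, ∀ t ∈ maximalIdeal A, s * t = 0)
    (ι : Γ →* GL (Fin n) A) (c : Matrix (Fin n) (Fin n) A → M)
    (hadd : ∀ x y : Matrix (Fin n) (Fin n) A, (∀ i j, x i j ∈ maximalIdeal A) →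
      (∀ i j, y i j ∈ maximalIdeal A) → c (x + y) = c x * c y)
    (hconj : ∀ (g : Γ) (x : Matrix (Fin n) (Fin n) A), (∀ i j, x i j ∈ maximalIdeal A) →
      c ((ι g : Matrix (Fin n) (Fin n) A) * x * ((ι g)⁻¹ : GL (Fin n) A)) = c x)
    (a : ℕ) (w f : Fin n → A) (hw : residue A ∘ w ∈ augmentationFlag (residualRep ι) a)
    (hf : ∀ w', residue A ∘ w' ∈ augmentationFlag (residualRep ι) a →
      f ⬝ᵥ w' ∈ maximalIdeal A)
    (t : A) (ht : t ∈ maximalIdeal A) : c (vecMulVec (t • w) f) = 1 := by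
  have hzero : c 0 = 1 := by simpa using hadd 0 0 (by simp) (by simp)
  have hmem : ∀ {s : A}, s ∈ maximalIdeal A → ∀ (w f : Fin n → A) (i j : Fin n),
      vecMulVec (s • w) f i j ∈ maximalIdeal A := fun hs w f i j =>
    Ideal.mul_mem_right _ _ (Ideal.mul_mem_right _ _ hs)
  induction a generalizing w f t with
  | zero =>
    convert hzero
    ext i j
    have hj : f j ∈ maximalIdeal A := by simpa using hf (Pi.single j 1) trivial
    simp only [vecMulVec_apply, Pi.smul_apply, smul_eq_mul, Matrix.zero_apply]
    rw [mul_right_comm, hm t ht _ hj, zero_mul]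
  | succ a ih =>
    generalize hv : residue A ∘ w = v at hw
    induction hw using Submodule.span_induction generalizing w t with
    | mem v hmv =>
      obtain ⟨g, v', hv', rfl⟩ := hmv
      obtain ⟨w', rfl⟩ := exists_lift_residue v'
      have hred : residue A ∘ w = residue A ∘ ((ι g : Matrix (Fin n) (Fin n) A) *ᵥ w' - w') := by
        rw [hv, residualRep_apply]
        ext i
        simp
      rw [smul_eq_smul_of_residue_eq hm ht hred]
      set f' : Fin n → A := f ᵥ* (ι g : Matrix (Fin n) (Fin n) A) with hf'
      have hsub : c (vecMulVec (t • w') (f' - f)) = 1 := by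
        refine ih w' _ hv' (fun u hu => ?_) t ht
        rw [hf', sub_dotProduct, ← dotProduct_mulVec, ← dotProduct_sub]
        refine hf _ (Submodule.subset_span ⟨g, _, hu, ?_⟩)
        rw [residualRep_apply]
        ext i
        simp
      have hg : c (vecMulVec (t • ((ι g : Matrix (Fin n) (Fin n) A) *ᵥ w')) f) =
          c (vecMulVec (t • w') f') := by
        rw [← hconj g _ (hmem ht w' f'), mul_vecMulVec, vecMulVec_mul, hf', vecMul_vecMul,
          mulVec_smul]
        simp
      have h1 := hadd (vecMulVec (t • w') (f' - f)) (vecMulVec (t • w') f)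
        (hmem ht _ _) (hmem ht _ _)
      rw [← vecMulVec_add, sub_add_cancel, hsub, one_mul] at h1
      have h2 := hadd (vecMulVec (t • ((ι g : Matrix (Fin n) (Fin n) A) *ᵥ w' - w')) f)
        (vecMulVec (t • w') f) (hmem ht _ _) (hmem ht _ _)
      rw [← add_vecMulVec, ← smul_add, sub_add_cancel, hg, h1] at h2
      exact (mul_eq_right.mp h2.symm)
    | zero =>
      have hred : residue A ∘ w = residue A ∘ (0 : Fin n → A) := by
        rw [hv]
        ext i
        simp
      rw [smul_eq_smul_of_residue_eq hm ht hred, smul_zero, zero_vecMulVec, hzero]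
    | add v₁ v₂ _ _ h₁ h₂ =>
      obtain ⟨w₁, rfl⟩ := exists_lift_residue v₁
      obtain ⟨w₂, rfl⟩ := exists_lift_residue v₂
      have hred : residue A ∘ w = residue A ∘ (w₁ + w₂) := by
        rw [hv]
        ext i
        simp
      rw [smul_eq_smul_of_residue_eq hm ht hred, smul_add, add_vecMulVec,
        hadd _ _ (hmem ht _ _) (hmem ht _ _), h₁ w₁ t ht rfl, h₂ w₂ t ht rfl, one_mul]
    | smul b v _ h =>
      obtain ⟨b, rfl⟩ := residue_surjective b
      obtain ⟨w', rfl⟩ := exists_lift_residue v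
      have hred : residue A ∘ w = residue A ∘ (b • w') := by
        rw [hv]
        ext i
        simp
      rw [smul_eq_smul_of_residue_eq hm ht hred, smul_smul]
      exact h w' _ (Ideal.mul_mem_right _ _ ht) rfl

/-- An exhaustive separated filtration over the residue field has an adapted basis that lifts to
the local ring. -/
theorem exists_adapted_generalLinearGroup (W : ℕ → Submodule (ResidueField A)
      (Fin n → ResidueField A)) (hW : Antitone W) (htop : W 0 = ⊤) (r : ℕ) (hr : W r = ⊥) :
    ∃ (S : GL (Fin n) A) (β : Fin n → ℕ),
      (∀ j, residue A ∘ (fun i => (S : Matrix (Fin n) (Fin n) A) i j) ∈ W (β j)) ∧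
      ∀ a w, residue A ∘ w ∈ W a → ∀ i, β i < a →
        (((S⁻¹ : GL (Fin n) A) : Matrix (Fin n) (Fin n) A) *ᵥ w) i ∈ maximalIdeal A := by
  obtain ⟨b, β, hb, hspan⟩ := exists_linearIndepOn_span_eq r W hW hr
  have hb_top : ⊤ ≤ Submodule.span (ResidueField A) (Set.range (Subtype.val : b → _)) := by
    rw [Subtype.range_coe, ← htop, ← hspan 0]
    exact Submodule.span_mono fun v hv => hv.1
  let B := Module.Basis.mk hb hb_top
  let B' := B.reindex (B.indexEquiv (Pi.basisFun (ResidueField A) (Fin n)))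
  have hB' : ∀ v ∈ b, ∃ j, B' j = v := fun v hv =>
    ⟨B.indexEquiv (Pi.basisFun (ResidueField A) (Fin n)) ⟨v, hv⟩, by simp [B', B]⟩
  have hB'mem : ∀ j, B' j ∈ b := fun j => by simp [B', B]
  choose L hL using fun j => exists_lift_residue (B' j)
  let S₀ : Matrix (Fin n) (Fin n) A := Matrix.of fun i j => L j i
  have hcol : (S₀.map (residue A)).col = B' := by
    ext j i
    exact congrFun (hL j) i
  have hdet : IsUnit S₀.det := by
    refine isUnit_of_map_unit (residue A) _ ?_
    rw [RingHom.map_det, ← Matrix.isUnit_iff_isUnit_det]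
    refine Matrix.linearIndependent_cols_iff_isUnit.mp ?_
    change LinearIndependent _ (S₀.map (residue A)).col
    rw [hcol]
    exact B'.linearIndependent
  let S : GL (Fin n) A := Matrix.GeneralLinearGroup.mk'' S₀ hdet
  refine ⟨S, fun j => β (B' j), fun j => ?_, fun a w hw i hi => ?_⟩
  · change residue A ∘ L j ∈ _
    rw [hL, ← hspan]
    exact Submodule.subset_span ⟨hB'mem j, le_rfl⟩
  · rw [← residue_eq_zero_iff, RingHom.map_mulVec]
    change (_ *ᵥ (residue A ∘ w)) i = 0
    rw [← hspan] at hw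
    generalize residue A ∘ w = v at hw
    induction hw using Submodule.span_induction with
    | mem v hv =>
      obtain ⟨j, rfl⟩ := hB' v hv.1
      have hij : i ≠ j := fun h => absurd hv.2 (by rw [← h]; lia)
      have hmul : ((S⁻¹ : GL (Fin n) A) : Matrix (Fin n) (Fin n) A) * S₀ = 1 :=
        congrArg Units.val (inv_mul_cancel S)
      have := congrArg (fun X => X.map (residue A)) hmul
      rw [Matrix.map_mul] at this
      rw [← hcol]
      calc _ = (((S⁻¹ : GL (Fin n) A) : Matrix (Fin n) (Fin n) A).map (residue A) *
              S₀.map (residue A)) i j := rfl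
        _ = 0 := by rw [this]; simp [hij]
    | zero => simp
    | add v w _ _ hv hw => rw [mulVec_add, Pi.add_apply, hv, hw, add_zero]
    | smul d v _ hv => rw [mulVec_smul, Pi.smul_apply, hv, smul_zero]

/-- The group of block unipotent matrices, the blocks being the fibres of `β`. -/
def blockUnipotent (R : Type*) [CommRing R] (β : Fin n → ℕ) : Subgroup (GL (Fin n) R) where
  carrier := {g | ∀ i j, β i ≤ β j → ((g : Matrix (Fin n) (Fin n) R) - 1) i j = 0}
  one_mem' := by simp
  mul_mem' := by
    intro g h hg hh i j hij
    have : ((g * h : GL (Fin n) R) : Matrix (Fin n) (Fin n) R) - 1 =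
        ((g : Matrix (Fin n) (Fin n) R) - 1) * ((h : Matrix (Fin n) (Fin n) R) - 1) +
          ((g : Matrix (Fin n) (Fin n) R) - 1) + ((h : Matrix (Fin n) (Fin n) R) - 1) := by
      rw [Units.val_mul]; noncomm_ring
    rw [this, Matrix.add_apply, Matrix.add_apply, hg i j hij, hh i j hij, add_zero, add_zero,
      Matrix.mul_apply]
    refine Finset.sum_eq_zero fun l _ => ?_
    rcases le_total (β i) (β l) with hl | hl
    · rw [hg i l hl, zero_mul]
    · rw [hh l j (hl.trans hij), mul_zero]
  inv_mem' := by
    intro g hg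
    have hinv : ((g⁻¹ : GL (Fin n) R) : Matrix (Fin n) (Fin n) R) - 1 =
        -((g : Matrix (Fin n) (Fin n) R) - 1) - ((g : Matrix (Fin n) (Fin n) R) - 1) *
          (((g⁻¹ : GL (Fin n) R) : Matrix (Fin n) (Fin n) R) - 1) := by
      have : (g : Matrix (Fin n) (Fin n) R) * ((g⁻¹ : GL (Fin n) R) : Matrix (Fin n) (Fin n) R)
          = 1 := congrArg Units.val (mul_inv_cancel g)
      rw [sub_mul, mul_sub, this]; noncomm_ring
    suffices ∀ b i j, β i = b → β i ≤ β j →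
        (((g⁻¹ : GL (Fin n) R) : Matrix (Fin n) (Fin n) R) - 1) i j = 0 from
      fun i j hij => this _ i j rfl hij
    intro b
    induction b using Nat.strong_induction_on with
    | _ b ih =>
      intro i j hb hij
      rw [hinv, Matrix.sub_apply, Matrix.neg_apply, hg i j hij, neg_zero, zero_sub, neg_eq_zero,
        Matrix.mul_apply]
      refine Finset.sum_eq_zero fun l _ => ?_
      rcases le_or_gt (β i) (β l) with hl | hl
      · rw [hg i l hl, zero_mul]
      · rw [ih (β l) (hb ▸ hl) l j rfl (hl.le.trans hij), mul_zero]

theorem matrix_mul_eq_zero (hm : ∀ s ∈ maximalIdeal A, ∀ t ∈ maximalIdeal A, s * t = 0)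
    {x y : Matrix (Fin n) (Fin n) A} (hx : ∀ i j, x i j ∈ maximalIdeal A)
    (hy : ∀ i j, y i j ∈ maximalIdeal A) : x * y = 0 := by
  ext i j
  rw [Matrix.mul_apply]
  exact Finset.sum_eq_zero fun l _ => hm _ (hx i l) _ (hy l j)

/-- Extension of invariant characters of the congruence kernel to `p`-groups containing it. -/
theorem exists_extension_of_isPGroup {p d : ℕ} [Fact p.Prime] [Finite Γ] [Finite A]
    (hΓ : IsPGroup p Γ) (hk : Nat.card (ResidueField A) = p ^ d)
    (hm : ∀ s ∈ maximalIdeal A, ∀ t ∈ maximalIdeal A, s * t = 0)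
    (ι : Γ →* GL (Fin n) A) (hι : Function.Injective ι)
    (hrange : ∀ g : GL (Fin n) A,
      (∀ i j, ((g : Matrix (Fin n) (Fin n) A) - 1) i j ∈ maximalIdeal A) → ∃ γ, ι γ = g)
    (N : Subgroup Γ) [hN : N.Normal]
    (hmem : ∀ γ, γ ∈ N ↔ ∀ i j, ((ι γ : Matrix (Fin n) (Fin n) A) - 1) i j ∈ maximalIdeal A)
    (χ : N →* M)
    (hinv : ∀ (g x : Γ) (hx : x ∈ N), χ ⟨g * x * g⁻¹, hN.conj_mem x hx g⟩ = χ ⟨x, hx⟩) :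
    ∃ θ : Γ →* M, ∀ x : N, θ x = χ x := by
  classical
  have hex : ∀ x : Matrix (Fin n) (Fin n) A, (∀ i j, x i j ∈ maximalIdeal A) →
      ∃ g : N, (ι g : Matrix (Fin n) (Fin n) A) = 1 + x := by
    intro x hx
    have hxx := matrix_mul_eq_zero hm hx hx
    obtain ⟨γ, hγ⟩ := hrange ⟨1 + x, 1 - x, by noncomm_ring; simp [hxx], by
      noncomm_ring; simp [hxx]⟩ (by simpa using hx)
    have hval : (ι γ : Matrix (Fin n) (Fin n) A) = 1 + x := by rw [hγ]
    exact ⟨⟨γ, (hmem γ).mpr (by simpa [hval] using hx)⟩, hval⟩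
  let c : Matrix (Fin n) (Fin n) A → M := fun x =>
    if h : ∃ g : N, (ι g : Matrix (Fin n) (Fin n) A) = 1 + x then χ h.choose else 1
  have hc : ∀ (g : N) (x : Matrix (Fin n) (Fin n) A),
      (ι g : Matrix (Fin n) (Fin n) A) = 1 + x → c x = χ g := by
    intro g x hg
    have h : ∃ g : N, (ι g : Matrix (Fin n) (Fin n) A) = 1 + x := ⟨g, hg⟩
    simp only [c, dif_pos h]
    congr 1
    exact Subtype.ext (hι (Units.ext (h.choose_spec.trans hg.symm)))
  have hadd : ∀ x y : Matrix (Fin n) (Fin n) A, (∀ i j, x i j ∈ maximalIdeal A) →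
      (∀ i j, y i j ∈ maximalIdeal A) → c (x + y) = c x * c y := by
    intro x y hx hy
    obtain ⟨g, hg⟩ := hex x hx
    obtain ⟨h, hh⟩ := hex y hy
    rw [hc g x hg, hc h y hh, ← map_mul]
    refine hc _ _ ?_
    rw [Subgroup.coe_mul, map_mul, Units.val_mul, hg, hh, mul_add, mul_one, add_mul,
      matrix_mul_eq_zero hm hx hy, one_mul, add_zero, add_assoc]
  have hconj : ∀ (g : Γ) (x : Matrix (Fin n) (Fin n) A), (∀ i j, x i j ∈ maximalIdeal A) →
      c ((ι g : Matrix (Fin n) (Fin n) A) * x * ((ι g)⁻¹ : GL (Fin n) A)) = c x := by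
    intro g x hx
    obtain ⟨h, hh⟩ := hex x hx
    rw [hc h x hh, ← hinv g h h.2]
    refine hc _ _ ?_
    rw [map_mul, map_mul, map_inv, Units.val_mul, Units.val_mul, hh, mul_add, add_mul, mul_one,
      Units.mul_inv]
  have hsum : ∀ {κ : Type} (s : Finset κ) (x : κ → Matrix (Fin n) (Fin n) A),
      (∀ l ∈ s, ∀ i j, x l i j ∈ maximalIdeal A) → (∀ l ∈ s, c (x l) = 1) →
      c (∑ l ∈ s, x l) = 1 := by
    intro κ s x hx h
    induction s using Finset.induction_on with
    | empty => simpa using hadd 0 0 (by simp) (by simp)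
    | insert l s hl ih =>
      rw [Finset.sum_insert hl, hadd _ _ (hx l (s.mem_insert_self l)) ?_,
        h l (s.mem_insert_self l), one_mul]
      · exact ih (fun l hl => hx l (s.mem_insert_of_mem hl))
          fun l hl => h l (s.mem_insert_of_mem hl)
      · intro i j
        rw [Matrix.sum_apply]
        exact Ideal.sum_mem _ fun l hl => hx l (s.mem_insert_of_mem hl) i j
  have : Finite (ResidueField A) := Finite.of_surjective _ residue_surjective
  have hcard : Nat.card (Fin n → ResidueField A) = p ^ (d * n) := by
    rw [Nat.card_fun, hk, Nat.card_fin, pow_mul]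
  obtain ⟨r, hr⟩ := exists_augmentationFlag_eq_bot hΓ hcard (residualRep ι)
  obtain ⟨S, β, hSβ, hSinv⟩ := exists_adapted_generalLinearGroup _
    (augmentationFlag_antitone (residualRep ι)) rfl r hr
  set T : Matrix (Fin n) (Fin n) A := ((S⁻¹ : GL (Fin n) A) : Matrix (Fin n) (Fin n) A) with hT
  have hTS : T * S = 1 := Units.inv_mul S
  have hST : (S : Matrix (Fin n) (Fin n) A) * T = 1 := Units.mul_inv S
  have hblock : ∀ g i j, β i ≤ β j → (T * ι g * S - 1) i j ∈ maximalIdeal A := by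
    intro g i j hij
    have heq : T * ι g * S - 1 = T * ((ι g : Matrix (Fin n) (Fin n) A) * S - S) := by
      rw [mul_sub, hTS, mul_assoc]
    rw [heq]
    refine hSinv (β j + 1) (fun l => ((ι g : Matrix (Fin n) (Fin n) A) * S - S) l j) ?_ i (by lia)
    refine Submodule.subset_span ⟨g, _, hSβ j, ?_⟩
    rw [residualRep_apply]
    ext l
    simp [Matrix.mul_apply, mulVec, dotProduct]
  refine exists_extension_of_supplement N
    ((blockUnipotent A β).comap ((MulAut.conj S⁻¹).toMonoidHom.comp ι)) χ hinv ?_ ?_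
  · intro g
    let Y : Matrix (Fin n) (Fin n) A := T * ι g * S
    let z : Matrix (Fin n) (Fin n) A := Matrix.of fun i j => if β i ≤ β j then (Y - 1) i j else 0
    have hz : ∀ i j, z i j ∈ maximalIdeal A := by
      intro i j
      by_cases hij : β i ≤ β j
      · simpa only [z, Matrix.of_apply, if_pos hij] using hblock g i j hij
      · simp [z, hij]
    obtain ⟨h, hh⟩ := hex (-(((ι g)⁻¹ : GL (Fin n) A) * (S * z * T))) fun i j => by
      rw [Matrix.neg_apply]
      exact neg_mem (mul_apply_mem_left _
        (mul_apply_mem_right _ (mul_apply_mem_left _ hz)) i j)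
    refine ⟨g * h, ?_, by simp⟩
    have hval : T * (ι (g * h) : Matrix (Fin n) (Fin n) A) * S = Y - z := by
      rw [map_mul, Units.val_mul, hh, mul_add, mul_one, mul_neg, ← mul_assoc, Units.mul_inv,
        one_mul, ← sub_eq_add_neg, mul_sub, sub_mul]
      congr 1
      calc T * (S * z * T) * S = (T * S) * z * (T * S) := by noncomm_ring
        _ = z := by rw [hTS, one_mul, mul_one]
    intro i j hij
    have : (((MulAut.conj S⁻¹).toMonoidHom.comp ι) (g * h) : Matrix (Fin n) (Fin n) A) =
        T * (ι (g * h) : Matrix (Fin n) (Fin n) A) * S := by simp [hT]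
    rw [this, hval, sub_right_comm, Matrix.sub_apply]
    simp [z, hij]
  · intro x hx hxU
    let X : Matrix (Fin n) (Fin n) A := (ι x : Matrix (Fin n) (Fin n) A) - 1
    let y : Matrix (Fin n) (Fin n) A := T * X * S
    have hy : ∀ i j, y i j ∈ maximalIdeal A :=
      mul_apply_mem_right _ (mul_apply_mem_left _ ((hmem x).mp hx))
    have hy0 : ∀ i j, β i ≤ β j → y i j = 0 := by
      intro i j hij
      have := hxU i j hij
      have heq : (((MulAut.conj S⁻¹).toMonoidHom.comp ι) x : Matrix (Fin n) (Fin n) A) - 1 =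
          y := by
        simp [y, X, mul_sub, sub_mul, hT]
      rwa [heq] at this
    have hX : X = ∑ l : Fin n × Fin n,
        vecMulVec (y l.1 l.2 • fun i => (S : Matrix (Fin n) (Fin n) A) i l.1) (T l.2) := by
      have hXy : X = S * y * T := by
        calc X = (S * T) * X * (S * T) := by rw [hST, one_mul, mul_one]
          _ = S * y * T := by simp only [y]; noncomm_ring
      ext i j
      rw [hXy, Matrix.sum_apply, Fintype.sum_prod_type_right, Matrix.mul_apply]
      refine Finset.sum_congr rfl fun l _ => ?_
      rw [Matrix.mul_apply, Finset.sum_mul]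
      refine Finset.sum_congr rfl fun l' _ => ?_
      simp only [vecMulVec_apply, Pi.smul_apply, smul_eq_mul]
      ring
    rw [← hc ⟨x, hx⟩ X (by simp [X]), hX]
    refine hsum _ _ (fun l _ i j => ?_) fun l _ => ?_
    · exact Ideal.mul_mem_right _ _ (Ideal.mul_mem_right _ _ (hy _ _))
    · rcases le_or_gt (β l.1) (β l.2) with hl | hl
      · rw [hy0 _ _ hl, zero_smul, zero_vecMulVec]
        simpa using hadd 0 0 (by simp) (by simp)
      · exact character_smul_vecMulVec_eq_one hm ι c hadd hconj (β l.1) _ _ (hSβ l.1)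
          (fun w hw => hSinv _ w hw l.2 hl) _ (hy _ _)

end Character

/-- **Character extension to the inertia group (Proposition 4.5) for `GLₙ`.** Let `A` be a
finite local ring of length two with residue field of cardinality `q = p ^ d`, let
`N = ker (GLₙ(A) → GLₙ(A/m))`, let `K` be algebraically closed with `char K ≠ p`, and let
`χ : N → Kˣ` be a character with inertia group `H`. Then `χ` extends to a character of
`H`. -/
theorem character_extends_to_inertia_group
    (p d n : ℕ) (hp : p.Prime) (hd : 1 ≤ d) (hn : 1 ≤ n) (q : ℕ) (hq : q = p ^ d)
    (K : Type*) [Field K] [IsAlgClosed K] (hK : ringChar K ≠ p)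
    (A : Type*) [CommRing A] [IsLocalRing A] [Fintype A]
    (hm : (IsLocalRing.maximalIdeal A) ^ 2 = ⊥)
    (hres : Nat.card (A ⧸ IsLocalRing.maximalIdeal A) = q)
    (hcard : Nat.card A = q ^ 2)
    (ρ : GL (Fin n) A →* GL (Fin n) (A ⧸ IsLocalRing.maximalIdeal A))
    (hρ : ρ = Matrix.GeneralLinearGroup.map (Ideal.Quotient.mk (IsLocalRing.maximalIdeal A)))
    (χ : (MonoidHom.ker ρ) →* Kˣ) :
    ∃ χext : (charStabilizer (MonoidHom.ker ρ) χ) →* Kˣ,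
      ∀ (x : GL (Fin n) A) (hx : x ∈ MonoidHom.ker ρ),
        ∃ hxH : x ∈ charStabilizer (MonoidHom.ker ρ) χ,
          χext ⟨x, hxH⟩ = χ ⟨x, hx⟩ := by
  classical
  have : Fact p.Prime := ⟨hp⟩
  have hm' : ∀ s ∈ IsLocalRing.maximalIdeal A, ∀ t ∈ IsLocalRing.maximalIdeal A, s * t = 0 := by
    intro s hs t ht
    have := Ideal.mul_mem_mul hs ht
    rwa [← pow_two, hm, Ideal.mem_bot] at this
  have hk : Nat.card (IsLocalRing.ResidueField A) = p ^ d := hres.trans hq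
  have hker : ∀ g : GL (Fin n) A, g ∈ ρ.ker ↔
      ∀ i j, ((g : Matrix (Fin n) (Fin n) A) - 1) i j ∈ IsLocalRing.maximalIdeal A := by
    intro g
    rw [MonoidHom.mem_ker, hρ, Matrix.GeneralLinearGroup.ext_iff]
    refine forall₂_congr fun i j => ?_
    rw [← Ideal.Quotient.eq_zero_iff_mem, Matrix.sub_apply, map_sub, sub_eq_zero]
    by_cases hij : i = j <;> simp [Matrix.one_apply, hij]
  have hcomm : ∀ g ∈ ρ.ker, ∀ x ∈ ρ.ker, g * x = x * g := by
    intro g hg x hx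
    rw [hker] at hg hx
    refine Units.ext (sub_eq_zero.mp ?_)
    have h1 := matrix_mul_eq_zero hm' hg hx
    have h2 := matrix_mul_eq_zero hm' hx hg
    rw [Units.val_mul, Units.val_mul]
    rw [← sub_eq_zero.mpr (h1.trans h2.symm)]
    noncomm_ring
  set H := charStabilizer ρ.ker χ with hH
  have hNH : ρ.ker ≤ H := by
    intro g hg x hx
    congr 2
    rw [hcomm g hg x hx, mul_inv_cancel_right]
  have hpow : ∀ g ∈ ρ.ker, g ^ p ^ d = 1 := by
    intro g hg
    rw [hker] at hg
    have hpd : ((p ^ d : ℕ) : A) ∈ IsLocalRing.maximalIdeal A := by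
      have : Finite (IsLocalRing.ResidueField A) :=
        Finite.of_surjective _ IsLocalRing.residue_surjective
      rw [← IsLocalRing.residue_eq_zero_iff, map_natCast, ← hk]
      simpa using card_nsmul_eq_zero' (x := (1 : IsLocalRing.ResidueField A))
    set x := (g : Matrix (Fin n) (Fin n) A) - 1 with hx
    have hbinom : ∀ e : ℕ, (1 + x) ^ e = 1 + (e : A) • x := by
      intro e
      induction e with
      | zero => simp
      | succ e ih =>
        rw [pow_succ, ih, add_mul, one_mul, mul_add, mul_one, smul_mul_assoc,
          matrix_mul_eq_zero hm' hg hg, smul_zero, add_zero, Nat.cast_succ, add_smul, one_smul]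
        abel
    refine Units.ext ?_
    rw [Units.val_pow_eq_pow_val, Units.val_one,
      show (g : Matrix (Fin n) (Fin n) A) = 1 + x by simp [hx], hbinom, add_eq_left]
    ext i j
    exact hm' _ hpd _ (hg i j)
  have hNp : IsPGroup p (ρ.ker.subgroupOf H) := fun x =>
    ⟨d, Subtype.ext (Subtype.ext (hpow _ x.2))⟩
  let χ' : ρ.ker.subgroupOf H →* Kˣ := χ.comp (Subgroup.subgroupOfEquivOfLe hNH).toMonoidHom
  have hχ' : ∀ (g x : H) (hx : x ∈ ρ.ker.subgroupOf H),
      χ' ⟨g * x * g⁻¹, (inferInstance : (ρ.ker.subgroupOf H).Normal).conj_mem x hx g⟩ =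
        χ' ⟨x, hx⟩ := fun g x hx => g.2 x hx
  obtain ⟨P, hP⟩ := hNp.exists_le_sylow
  obtain ⟨θ, hθ⟩ := exists_extension_of_isPGroup P.isPGroup' hk hm'
    (H.subtype.comp (P : Subgroup H).subtype)
    (H.subtype_injective.comp (P : Subgroup H).subtype_injective)
    (fun g hg => by
      rw [← hker] at hg
      exact ⟨⟨⟨g, hNH hg⟩, hP hg⟩, rfl⟩)
    ((ρ.ker.subgroupOf H).subgroupOf P) (fun γ => hker _)
    (χ'.comp (Subgroup.subgroupOfEquivOfLe hP).toMonoidHom) (fun g x hx => hχ' g x hx)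
  have hcop : (P : Subgroup H).index.Coprime (Nat.card (ρ.ker.subgroupOf H)) := by
    obtain ⟨e, he⟩ := IsPGroup.iff_card.mp hNp
    rw [he]
    exact (hp.coprime_pow_of_not_dvd P.not_dvd_index)
  obtain ⟨χext, hχext⟩ := exists_extension_of_coprime_index _ (P : Subgroup H) hP hcop χ' hχ' θ
    (fun x hx => hθ ⟨⟨x, hP hx⟩, hx⟩)
  exact ⟨χext, fun x hx => ⟨hNH hx, hχext ⟨⟨x, hNH hx⟩, hx⟩⟩⟩
end

section
/- Let p be a prime, d ≥ 1, q = p^d, n ≥ 1, and let K be an algebraically closed field with char K ≠ p. Let A be a finite commutative local ring whose maximal ideal m satisfies m² = 0, |A/m| = q, and |A| = q². Let G = GL_n(A), let ρ : GL_n(A) → GL_n(A/m) be reduction modulo m, and N = ker ρ. Let χ : N →* Kˣ be a group homomorphism, H = {g ∈ G : ∀ x ∈ N, χ(g·x·g⁻¹) = χ(x)} its stabilizer, and set e = |N|⁻¹ · Σ_{x ∈ N} χ(x)⁻¹ · [x] in the group algebra K[H] (note |N| is invertible in K since char K ≠ p). Then e is a central idempotent of K[H], and the K-algebra e·K[H]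 (with identity e) is isomorphic to the group algebra K[H/N]. -/
open Matrix

section KerAbelian

variable {n : ℕ} {A : Type*} [CommRing A] [IsLocalRing A]

/-- Entries of `x - 1` lie in the maximal ideal, for `x` in the kernel of reduction. -/
theorem entry_sub_one_mem_maximalIdeal
    (x : GL (Fin n) A)
    (hx : Matrix.GeneralLinearGroup.map (Ideal.Quotient.mk (IsLocalRing.maximalIdeal A)) x = 1)
    (i j : Fin n) :
    ((x : Matrix (Fin n) (Fin n) A) - 1) i j ∈ IsLocalRing.maximalIdeal A := by
  set m := IsLocalRing.maximalIdeal A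
  have h1 : Ideal.Quotient.mk m ((x : Matrix (Fin n) (Fin n) A) i j) =
      (1 : Matrix (Fin n) (Fin n) (A ⧸ m)) i j := by
    have := congrArg (fun u : GL (Fin n) (A ⧸ m) => (u : Matrix (Fin n) (Fin n) (A ⧸ m)) i j) hx
    simpa using this
  have h2 : Ideal.Quotient.mk m ((1 : Matrix (Fin n) (Fin n) A) i j) =
      (1 : Matrix (Fin n) (Fin n) (A ⧸ m)) i j := by
    by_cases h : i = j <;> simp [Matrix.one_apply, h]
  rw [← Ideal.Quotient.eq_zero_iff_mem, Matrix.sub_apply, map_sub, h1, h2, sub_self]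

/-- The kernel of reduction is abelian when the maximal ideal has square zero. -/
theorem ker_red_comm
    (hm : (IsLocalRing.maximalIdeal A) ^ 2 = ⊥)
    (ρ : GL (Fin n) A →* GL (Fin n) (A ⧸ IsLocalRing.maximalIdeal A))
    (hρ : ρ = Matrix.GeneralLinearGroup.map (Ideal.Quotient.mk (IsLocalRing.maximalIdeal A)))
    {x y : GL (Fin n) A} (hx : x ∈ MonoidHom.ker ρ) (hy : y ∈ MonoidHom.ker ρ) :
    x * y = y * x := by
  subst hρ
  rw [MonoidHom.mem_ker] at hx hy
  set m := IsLocalRing.maximalIdeal A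
  set a := (x : Matrix (Fin n) (Fin n) A) - 1 with ha_def
  set b := (y : Matrix (Fin n) (Fin n) A) - 1 with hb_def
  have ha : ∀ i j, a i j ∈ m := entry_sub_one_mem_maximalIdeal x hx
  have hb : ∀ i j, b i j ∈ m := entry_sub_one_mem_maximalIdeal y hy
  have hmm : m * m = ⊥ := by rw [← pow_two]; exact hm
  have hab : a * b = 0 := by
    apply Matrix.ext
    intro i j
    rw [Matrix.mul_apply]
    rw [Matrix.zero_apply]
    apply Finset.sum_eq_zero
    intro k _
    have h := Ideal.mul_mem_mul (ha i k) (hb k j)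
    rw [hmm] at h
    exact Ideal.mem_bot.mp h
  have hba : b * a = 0 := by
    apply Matrix.ext
    intro i j
    rw [Matrix.mul_apply]
    rw [Matrix.zero_apply]
    apply Finset.sum_eq_zero
    intro k _
    have h := Ideal.mul_mem_mul (hb i k) (ha k j)
    rw [hmm] at h
    exact Ideal.mem_bot.mp h
  apply Units.ext
  show (x : Matrix (Fin n) (Fin n) A) * y = (y : Matrix (Fin n) (Fin n) A) * x
  have ex : (x : Matrix (Fin n) (Fin n) A) = 1 + a := by rw [ha_def]; abel
  have ey : (y : Matrix (Fin n) (Fin n) A) = 1 + b := by rw [hb_def]; abel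
  rw [ex, ey]
  have e1 : (1 + a) * (1 + b) = 1 + a + b + a * b := by noncomm_ring
  have e2 : (1 + b) * (1 + a) = 1 + b + a + b * a := by noncomm_ring
  rw [e1, e2, hab, hba]
  abel

/-- The kernel of reduction is contained in the inertia group of any of its characters. -/
theorem ker_le_charStabilizer
    (hm : (IsLocalRing.maximalIdeal A) ^ 2 = ⊥)
    (K : Type*) [Field K]
    (ρ : GL (Fin n) A →* GL (Fin n) (A ⧸ IsLocalRing.maximalIdeal A))
    (hρ : ρ = Matrix.GeneralLinearGroup.map (Ideal.Quotient.mk (IsLocalRing.maximalIdeal A)))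
    (χ : (MonoidHom.ker ρ) →* Kˣ) :
    MonoidHom.ker ρ ≤ charStabilizer (MonoidHom.ker ρ) χ := by
  intro g hg x hx
  have hc : g * x * g⁻¹ = x := by
    rw [ker_red_comm hm ρ hρ hg hx]
    group
  exact congrArg χ (Subtype.ext hc)

end KerAbelian

/-- The (non-unital) corner algebra `{x | b * x = x}` attached to an idempotent `b` of an
algebra; for a central idempotent this is the ideal `b·A`, a `K`-algebra with identity
`b`. -/
def cornerAlgebra (K : Type*) [Field K] (A : Type*) [Ring A] [Algebra K A] (b : A) :
    NonUnitalSubalgebra K A where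
  carrier := {x | b * x = x}
  add_mem' := by
    intro x y hx hy
    simp only [Set.mem_setOf_eq] at *
    rw [mul_add, hx, hy]
  zero_mem' := mul_zero b
  mul_mem' := by
    intro x y hx hy
    simp only [Set.mem_setOf_eq] at *
    rw [← mul_assoc, hx]
  smul_mem' := by
    intro c x hx
    simp only [Set.mem_setOf_eq] at *
    rw [mul_smul_comm, hx]

section GroupAlgebra

variable {K : Type*} [Field K] {H : Type*} [Group H] {N : Subgroup H}

/-- The idempotent of `K[N]`, viewed in `K[H]`, attached to the restriction to `N` of a
linear character of `H`. -/
noncomputable def charIdempotent (N : Subgroup H) [Fintype N] (τ : H →* Kˣ) :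
    MonoidAlgebra K H :=
  (Nat.card N : K)⁻¹ • ∑ x : N, (((τ x)⁻¹ : Kˣ) : K) • MonoidAlgebra.single (x : H) (1 : K)

theorem single_mul_charIdempotent [Fintype N] (τ : H →* Kˣ) (x : N) :
    MonoidAlgebra.single (x : H) (1 : K) * charIdempotent N τ =
      ((τ x : Kˣ) : K) • charIdempotent N τ := by
  rw [charIdempotent, mul_smul_comm, smul_comm (((τ x : Kˣ) : K)), Finset.mul_sum,
    Finset.smul_sum (r := ((τ x : Kˣ) : K))]
  congr 1
  refine Fintype.sum_equiv (Equiv.mulLeft x) _ _ fun y => ?_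
  simp [MonoidAlgebra.single_mul_single, mul_comm]

theorem single_mul_charIdempotent_comm [N.Normal] [Fintype N] (τ : H →* Kˣ) (h : H) :
    MonoidAlgebra.single h (1 : K) * charIdempotent N τ =
      charIdempotent N τ * MonoidAlgebra.single h (1 : K) := by
  rw [charIdempotent, mul_smul_comm, smul_mul_assoc, Finset.mul_sum, Finset.sum_mul]
  congr 1
  refine Fintype.sum_equiv (MulAut.conjNormal h).toEquiv _ _ fun y => ?_
  simp [MonoidAlgebra.single_mul_single, mul_comm]

theorem mul_charIdempotent_comm [N.Normal] [Fintype N] (τ : H →* Kˣ) (a : MonoidAlgebra K H) :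
    a * charIdempotent N τ = charIdempotent N τ * a := by
  induction a using MonoidAlgebra.induction_on with
  | of h => exact single_mul_charIdempotent_comm τ h
  | add a b ha hb => rw [add_mul, mul_add, ha, hb]
  | smul r a ha => rw [smul_mul_assoc, mul_smul_comm, ha]

/-- The algebra map `[h] ↦ τ(h) [hN]` from `K[H]` to `K[H/N]`. -/
noncomputable def twistedProjection (N : Subgroup H) [N.Normal] (τ : H →* Kˣ) :
    MonoidAlgebra K H →ₐ[K] MonoidAlgebra K (H ⧸ N) :=
  MonoidAlgebra.lift K (MonoidAlgebra K (H ⧸ N)) H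
    { toFun := fun h => ((τ h : Kˣ) : K) • MonoidAlgebra.single (h : H ⧸ N) (1 : K)
      map_one' := by simp [MonoidAlgebra.one_def]
      map_mul' := fun a b => by simp [MonoidAlgebra.single_mul_single, mul_comm] }

theorem twistedProjection_single [N.Normal] (τ : H →* Kˣ) (h : H) (r : K) :
    twistedProjection N τ (MonoidAlgebra.single h r) =
      r • ((τ h : Kˣ) : K) • MonoidAlgebra.single (h : H ⧸ N) (1 : K) := by
  simp [twistedProjection, MonoidAlgebra.lift_single]

theorem twistedProjection_charIdempotent [N.Normal] [Fintype N] (hN : (Nat.card N : K) ≠ 0)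
    (τ : H →* Kˣ) :
    twistedProjection N τ (charIdempotent N τ) = 1 := by
  have h1 : ∀ x : N, ((x : H) : H ⧸ N) = 1 := fun x =>
    (QuotientGroup.eq_one_iff (x : H)).2 x.2
  rw [Nat.card_eq_fintype_card] at hN
  simp [charIdempotent, twistedProjection_single, h1, ← MonoidAlgebra.one_def,
    ← Nat.cast_smul_eq_nsmul K, smul_smul, hN]

theorem twistedProjection_surjective [N.Normal] (τ : H →* Kˣ) :
    Function.Surjective (twistedProjection (K := K) N τ) := by
  intro b
  induction b using MonoidAlgebra.induction_on with
  | of c =>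
    obtain ⟨h, rfl⟩ := QuotientGroup.mk_surjective c
    exact ⟨MonoidAlgebra.single h (((τ h)⁻¹ : Kˣ) : K), by
      simp [twistedProjection_single]⟩
  | add a b ha hb =>
    obtain ⟨a, rfl⟩ := ha
    obtain ⟨b, rfl⟩ := hb
    exact ⟨a + b, map_add _ _ _⟩
  | smul r a ha =>
    obtain ⟨a, rfl⟩ := ha
    exact ⟨r • a, map_smul _ _ _⟩

/-- A linear map which recovers `a * e` from the twisted projection of `a`. -/
theorem exists_twistedProjection_section [N.Normal] [Fintype N] (τ : H →* Kˣ) :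
    ∃ S : MonoidAlgebra K (H ⧸ N) →ₗ[K] MonoidAlgebra K H,
      ∀ a, S (twistedProjection N τ a) = a * charIdempotent N τ := by
  refine ⟨(Finsupp.linearCombination K fun c : H ⧸ N =>
    (((τ c.out)⁻¹ : Kˣ) : K) • (MonoidAlgebra.single c.out (1 : K) * charIdempotent N τ)) ∘ₗ
      (MonoidAlgebra.coeffLinearEquiv K).toLinearMap, fun a => ?_⟩
  induction a using MonoidAlgebra.induction_on with
  | of h =>
    obtain ⟨x, hx⟩ := QuotientGroup.mk_out_eq_mul N h
    have hout : MonoidAlgebra.single (h * (x : H)) (1 : K) * charIdempotent N τ =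
        ((τ x : Kˣ) : K) • (MonoidAlgebra.single h (1 : K) * charIdempotent N τ) := by
      rw [← mul_smul_comm, ← single_mul_charIdempotent, ← mul_assoc,
        MonoidAlgebra.single_mul_single, one_mul]
    simp only [MonoidAlgebra.of_apply, twistedProjection_single, map_smul,
      LinearMap.comp_apply, LinearEquiv.coe_coe, MonoidAlgebra.coeffLinearEquiv_apply,
      MonoidAlgebra.coeff_single, Finsupp.linearCombination_single, hx, hout, smul_smul,
      ← Units.val_mul, map_mul]
    simp
  | add a b ha hb => rw [map_add, map_add, ha, hb, add_mul]
  | smul r a ha => rw [map_smul, map_smul, ha, smul_mul_assoc]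

theorem isIdempotentElem_charIdempotent [N.Normal] [Fintype N] (hN : (Nat.card N : K) ≠ 0)
    (τ : H →* Kˣ) :
    IsIdempotentElem (charIdempotent N τ) := by
  obtain ⟨S, hS⟩ := exists_twistedProjection_section (N := N) τ
  rw [IsIdempotentElem, ← hS, twistedProjection_charIdempotent hN,
    ← map_one (twistedProjection (K := K) N τ), hS, one_mul]

/-- If the character `τ|N` extends to `H`, the block of `K[H]` it cuts out is `K[H/N]`. -/
theorem exists_corner_iso_quotient [N.Normal] [Fintype N] (hN : (Nat.card N : K) ≠ 0)
    (τ : H →* Kˣ) (e : MonoidAlgebra K H) (he : e = charIdempotent N τ) :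
    ∃ hidem : IsIdempotentElem e, (∀ a, a * e = e * a) ∧
      ∃ f : cornerAlgebra K (MonoidAlgebra K H) e →ₙₐ[K] MonoidAlgebra K (H ⧸ N),
        Function.Bijective f ∧ f ⟨e, hidem⟩ = 1 := by
  subst he
  obtain ⟨S, hS⟩ := exists_twistedProjection_section (N := N) τ
  refine ⟨isIdempotentElem_charIdempotent hN τ, mul_charIdempotent_comm τ,
    ((twistedProjection N τ : MonoidAlgebra K H →ₐ[K] _) :
      MonoidAlgebra K H →ₙₐ[K] MonoidAlgebra K (H ⧸ N)).comp
      (NonUnitalSubalgebraClass.subtype (cornerAlgebra K (MonoidAlgebra K H) _)),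
    ⟨?_, ?_⟩, twistedProjection_charIdempotent hN τ⟩
  · rintro ⟨a, ha⟩ ⟨b, hb⟩ hab
    have hab' : twistedProjection N τ a = twistedProjection N τ b := hab
    have ha' : charIdempotent N τ * a = a := ha
    have hb' : charIdempotent N τ * b = b := hb
    refine Subtype.ext ?_
    change a = b
    rw [← ha', ← hb', ← mul_charIdempotent_comm, ← mul_charIdempotent_comm, ← hS, ← hS, hab']
  · intro b
    obtain ⟨a, rfl⟩ := twistedProjection_surjective τ b
    refine ⟨⟨charIdempotent N τ * a, ?_⟩, ?_⟩
    · change charIdempotent N τ * (charIdempotent N τ * a) = charIdempotent N τ * a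
      rw [← mul_assoc, isIdempotentElem_charIdempotent hN τ]
    · change twistedProjection N τ (charIdempotent N τ * a) = twistedProjection N τ a
      rw [map_mul, twistedProjection_charIdempotent hN, one_mul]

end GroupAlgebra

section CharacterExtension

variable {G M : Type*} [Group G] [CommGroup M]

/-- The transfer of a character which is `G`-invariant on a normal subgroup `N` restricts
to a power of it on `N`. -/
theorem transfer_eq_pow_index {N P : Subgroup G} [N.Normal] [P.FiniteIndex] (hNP : N ≤ P)
    (φ : P →* M)
    (hφ : ∀ (g x : G) (hx : x ∈ N) (hgx : g⁻¹ * x * g ∈ N),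
      φ ⟨g⁻¹ * x * g, hNP hgx⟩ = φ ⟨x, hNP hx⟩)
    (x : G) (hx : x ∈ N) : φ.transfer x = φ ⟨x, hNP hx⟩ ^ P.index := by
  classical
  let := P.fintypeQuotientOfFiniteIndex
  rw [MonoidHom.transfer_eq_prod_quotient_orbitRel_zpowers_quot,
    Subgroup.index_eq_sum_minimalPeriod P x, ← Finset.prod_pow_eq_pow_sum]
  refine Finset.prod_congr rfl fun q _ => ?_
  have hpow := N.pow_mem hx (Function.minimalPeriod (x • ·) q.out)
  rw [hφ _ _ hpow (by simpa using ‹N.Normal›.conj_mem _ hpow (q.out.out)⁻¹), ← map_pow]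
  rfl

/-- A character of exponent `p` on a normal subgroup which extends to a subgroup of index
prime to `p` extends to the whole group. -/
theorem exists_extension_of_coprime_index_s15 {N P : Subgroup G} [N.Normal] [P.FiniteIndex]
    (hNP : N ≤ P) {p : ℕ} (hp : p.Coprime P.index) (φ : P →* M)
    (hφ : ∀ (g x : G) (hx : x ∈ N) (hgx : g⁻¹ * x * g ∈ N),
      φ ⟨g⁻¹ * x * g, hNP hgx⟩ = φ ⟨x, hNP hx⟩)
    (hpow : ∀ (x : G) (hx : x ∈ N), φ ⟨x, hNP hx⟩ ^ p = 1) :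
    ∃ τ : G →* M, ∀ (x : G) (hx : x ∈ N), τ x = φ ⟨x, hNP hx⟩ := by
  refine ⟨(zpowGroupHom (P.index.gcdA p)).comp φ.transfer, fun x hx => ?_⟩
  have hbez : (1 : ℤ) = P.index * P.index.gcdA p + p * P.index.gcdB p := by
    rw [← Nat.gcd_eq_gcd_ab, hp.symm.gcd_eq_one, Nat.cast_one]
  change φ.transfer x ^ P.index.gcdA p = _
  rw [transfer_eq_pow_index hNP φ hφ x hx]
  conv_rhs => rw [← zpow_one (φ _), hbez, _root_.zpow_add, _root_.zpow_mul, _root_.zpow_mul,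
    zpow_natCast, zpow_natCast, hpow x hx, _root_.one_zpow, mul_one]

/-- A character of a normal subgroup `N` extends to a subgroup `P ≤ N T` which stabilizes
it, provided it is trivial on `N ∩ T`. -/
theorem exists_extension_of_trivial_on_inf {N P T : Subgroup G} [hN : N.Normal] (χ : N →* M)
    (hNP : N ≤ P)
    (hstab : ∀ g ∈ P, ∀ (x : G) (hx : x ∈ N), χ ⟨g * x * g⁻¹, hN.conj_mem x hx g⟩ = χ ⟨x, hx⟩)
    (hT : ∀ (x : G) (hx : x ∈ N), x ∈ T → χ ⟨x, hx⟩ = 1)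
    (hPT : ∀ g ∈ P, ∃ x ∈ N, ∃ t ∈ T, g = x * t) :
    ∃ φ : P →* M, ∀ (x : G) (hx : x ∈ N), φ ⟨x, hNP hx⟩ = χ ⟨x, hx⟩ := by
  choose! ν hν t ht hνt using hPT
  have key : ∀ (x : N) (g : G) (hg : g ∈ P), (x : G)⁻¹ * g ∈ T → χ ⟨ν g, hν g hg⟩ = χ x := by
    intro x g hg hxg
    have hmem : (x : G)⁻¹ * ν g ∈ T := by
      have : (x : G)⁻¹ * ν g = (x : G)⁻¹ * g * (t g)⁻¹ := by
        rw [mul_assoc, ← eq_mul_inv_of_mul_eq (hνt g hg).symm]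
      rw [this]
      exact T.mul_mem hxg (T.inv_mem (ht g hg))
    have h := hT _ (N.mul_mem (N.inv_mem x.2) (hν g hg)) hmem
    have h2 : χ (x⁻¹ * ⟨ν g, hν g hg⟩) = 1 := h
    rwa [map_mul, map_inv, inv_mul_eq_one, eq_comm] at h2
  refine ⟨MonoidHom.mk' (fun g => χ ⟨ν g, hν g g.2⟩) fun a b => ?_, fun x hx => ?_⟩
  · have htP : t a ∈ P := by
      have : t a = (ν a)⁻¹ * a := by rw [eq_inv_mul_iff_mul_eq, ← hνt a a.2]
      rw [this]
      exact P.mul_mem (P.inv_mem (hNP (hν a a.2))) a.2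
    rw [← hstab (t a) htP (ν b) (hν b b.2), ← map_mul]
    refine key _ _ (a * b).2 ?_
    have : ((⟨ν a, hν a a.2⟩ * ⟨t a * ν b * (t a)⁻¹, hN.conj_mem _ (hν b b.2) (t a)⟩ : N) : G)⁻¹ *
        ((a * b : P) : G) = t a * t b := by
      have e1 : ((a * b : P) : G) = ν a * t a * (ν b * t b) := by
        rw [← hνt a a.2, ← hνt b b.2]; rfl
      rw [e1]
      change (ν a * (t a * ν b * (t a)⁻¹))⁻¹ * _ = _
      group
    rw [this]
    exact T.mul_mem (ht a a.2) (ht b b.2)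
  · exact key ⟨x, hx⟩ x (hNP hx) (by simp [T.one_mem])

end CharacterExtension

section FixedSeries

variable {F V U : Type*} [Field F] [AddCommGroup V] [Module F V] [Group U]

/-- The ascending series of a representation: each quotient consists of the fixed vectors of
the quotient by the preceding term. -/
def fixedSeries (σ : U →* Module.End F V) : ℕ → Submodule F V
  | 0 => ⊥
  | k + 1 => ⨅ g : U, (fixedSeries σ k).comap (σ g - 1)

theorem mem_fixedSeries_succ {σ : U →* Module.End F V} {k : ℕ} {v : V} :
    v ∈ fixedSeries σ (k + 1) ↔ ∀ g, σ g v - v ∈ fixedSeries σ k := by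
  simp [fixedSeries]

theorem fixedSeries_monotone (σ : U →* Module.End F V) : Monotone (fixedSeries σ) := by
  refine monotone_nat_of_le_succ fun k => ?_
  induction k with
  | zero => exact bot_le
  | succ k ih =>
    exact fun v hv => mem_fixedSeries_succ.2 fun g => ih (mem_fixedSeries_succ.1 hv g)

theorem map_mem_fixedSeries (σ : U →* Module.End F V) {k : ℕ} {v : V}
    (hv : v ∈ fixedSeries σ k) (g : U) : σ g v ∈ fixedSeries σ k := by
  have h := mem_fixedSeries_succ.1 (fixedSeries_monotone σ k.le_succ hv) g
  simpa using add_mem h hv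

/-- The fixed series of a `p`-group in characteristic `p` exhausts the space. -/
theorem exists_fixedSeries_eq_top {p : ℕ} [Fact p.Prime] [Finite F] [Finite V]
    (hF : p ∣ Nat.card F) (hU : IsPGroup p U) (σ : U →* Module.End F V) :
    ∃ r, fixedSeries σ r = ⊤ := by
  obtain ⟨r, hr⟩ := monotone_stabilizes_iff_noetherian.2 (inferInstance : IsNoetherian F V)
    ⟨fixedSeries σ, fixedSeries_monotone σ⟩
  refine ⟨r, ?_⟩
  by_contra hne
  set W := fixedSeries σ r
  have hsucc : W = fixedSeries σ (r + 1) := hr (r + 1) r.le_succ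
  have hmap : ∀ g, W ≤ W.comap (σ g) := fun g v hv => map_mem_fixedSeries σ hv g
  let _ : MulAction U (V ⧸ W) :=
    { smul := fun g => W.mapQ W (σ g) (hmap g)
      one_smul := fun x => by
        obtain ⟨v, rfl⟩ := W.mkQ_surjective x
        change W.mapQ W (σ 1) (hmap 1) (W.mkQ v) = W.mkQ v
        simp
      mul_smul := fun g h x => by
        obtain ⟨v, rfl⟩ := W.mkQ_surjective x
        change W.mapQ W (σ (g * h)) (hmap _) (W.mkQ v) =
          W.mapQ W (σ g) (hmap g) (W.mapQ W (σ h) (hmap h) (W.mkQ v))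
        simp }
  have hsmul : ∀ (g : U) (v : V), g • W.mkQ v = W.mkQ (σ g v) := fun g v => rfl
  have hnt : Nontrivial (V ⧸ W) := Submodule.Quotient.nontrivial_iff.2 hne
  have hfin : Finite (V ⧸ W) := Finite.of_surjective W.mkQ W.mkQ_surjective
  have hcard : p ∣ Nat.card (V ⧸ W) := by
    rw [Module.natCard_eq_pow_finrank (K := F)]
    exact hF.trans (dvd_pow_self _ Module.finrank_pos.ne')
  have hzero : (0 : V ⧸ W) ∈ MulAction.fixedPoints U (V ⧸ W) := fun g => by
    rw [← map_zero W.mkQ, hsmul, map_zero]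
  obtain ⟨x, hx, hx0⟩ := hU.exists_fixed_point_of_prime_dvd_card_of_fixed_point _ hcard hzero
  obtain ⟨v, rfl⟩ := W.mkQ_surjective x
  refine hx0 (Eq.symm ?_)
  rw [Submodule.mkQ_apply, Submodule.Quotient.mk_eq_zero, hsucc, mem_fixedSeries_succ]
  intro g
  have h := hx g
  rwa [hsmul, Submodule.mkQ_apply, Submodule.mkQ_apply, Submodule.Quotient.eq] at h

/-- An additive functional on endomorphisms which is invariant under conjugation kills the
rank one maps `λ(·) v` with `v` in a term of the fixed series on which `λ` vanishes. -/
theorem apply_smulRight_eq_zero_of_mem_fixedSeries [FiniteDimensional F V]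
    {Z : Type*} [AddCommGroup Z] (σ : U →* Module.End F V) (Θ : Module.End F V →+ Z)
    (hΘ : ∀ g f, Θ (σ g * f) = Θ (f * σ g)) (k : ℕ) {v : V} (hv : v ∈ fixedSeries σ k)
    {l : Module.Dual F V} (hl : l ∈ (fixedSeries σ k).dualAnnihilator) :
    Θ (l.smulRight v) = 0 := by
  induction k generalizing v l with
  | zero =>
    have h0 : v = 0 := (Submodule.mem_bot F).1 hv
    have : l.smulRight v = 0 := by ext; simp [h0]
    rw [this, map_zero]
  | succ k ih =>
    let D : Submodule F (Module.Dual F V) :=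
      { carrier := {l | ∀ a : F, Θ ((a • l).smulRight v) = 0}
        add_mem' := fun {l₁ l₂} h₁ h₂ a => by
          have : (a • (l₁ + l₂)).smulRight v = (a • l₁).smulRight v + (a • l₂).smulRight v := by
            ext; simp [add_smul]
          rw [this, map_add, h₁ a, h₂ a, add_zero]
        zero_mem' := fun a => by
          have : (a • (0 : Module.Dual F V)).smulRight v = 0 := by ext; simp
          rw [this, map_zero]
        smul_mem' := fun c l h a => by rw [smul_smul]; exact h (a * c) }
    have hD : ∀ l ∈ (fixedSeries σ k).dualAnnihilator, ∀ g, l ∘ₗ σ g - l ∈ D := by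
      intro l hl g a
      have h0 := ih (mem_fixedSeries_succ.1 hv g) (Submodule.smul_mem _ a hl)
      have e1 : (a • (l ∘ₗ σ g - l)).smulRight v =
          (a • l).smulRight v * σ g - (a • l).smulRight v := by
        ext; simp [mul_sub, sub_smul]
      have e2 : (a • l).smulRight (σ g v - v) =
          σ g * (a • l).smulRight v - (a • l).smulRight v := by
        ext; simp [smul_sub]
      rw [e2, map_sub, hΘ] at h0
      rw [e1, map_sub, h0]
    have hco : D.dualCoannihilator ≤ fixedSeries σ (k + 1) := by
      intro x hx
      rw [Submodule.mem_dualCoannihilator] at hx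
      refine mem_fixedSeries_succ.2 fun g => ?_
      rw [← Subspace.dualAnnihilator_dualCoannihilator_eq (W := fixedSeries σ k),
        Submodule.mem_dualCoannihilator]
      intro l hl
      simpa using hx _ (hD l hl g)
    have hlD : l ∈ D := by
      rw [← Subspace.dualCoannihilator_dualAnnihilator_eq (W := D)]
      exact Submodule.dualAnnihilator_anti hco hl
    simpa using hlD 1

/-- A chain of subspaces from `⊥` to `⊤` admits an adapted basis. -/
theorem exists_basis_adapted_to_chain [FiniteDimensional F V] {n : ℕ}
    (hn : Module.finrank F V = n)
    (W : ℕ → Submodule F V) (hW : Monotone W) (h0 : W 0 = ⊥) {r : ℕ} (hr : W r = ⊤) :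
    ∃ (b : Module.Basis (Fin n) F V) (w : Fin n → ℕ), (∀ i, b i ∈ W (w i)) ∧
      ∀ k, ∀ v ∈ W k, ∀ i, k < w i → b.repr v i = 0 := by
  classical
  have hs : ∀ k, ∃ s : Set V, s ⊆ W k ∧ LinearIndepOn F id s ∧
      ∀ j ≤ k, W j ≤ Submodule.span F (s ∩ W j) := by
    intro k
    induction k with
    | zero =>
      refine ⟨∅, Set.empty_subset _, linearIndepOn_empty F id, fun j hj => ?_⟩
      rw [Nat.le_zero.1 hj, h0]
      exact bot_le
    | succ k ih =>
      obtain ⟨s, hsW, hli, hspan⟩ := ih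
      obtain ⟨t, htW, hst, hWt, hlit⟩ :=
        exists_linearIndepOn_id_extension hli (hsW.trans (hW k.le_succ))
      refine ⟨t, htW, hlit, fun j hj => ?_⟩
      rcases Nat.le_succ_iff.1 hj with hj | rfl
      · exact (hspan j hj).trans (Submodule.span_mono (Set.inter_subset_inter_left _ hst))
      · rwa [Set.inter_eq_left.2 htW]
  obtain ⟨s, -, hli, hspan⟩ := hs r
  have hspan_top : ⊤ ≤ Submodule.span F (Set.range ((↑) : s → V)) := by
    rw [Subtype.range_coe, ← hr]
    exact (hspan r le_rfl).trans (Submodule.span_mono Set.inter_subset_left)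
  let b₀ : Module.Basis s F V := Module.Basis.mk hli hspan_top
  have hfin : Fintype s := FiniteDimensional.fintypeBasisIndex b₀
  let ε : s ≃ Fin n := Fintype.equivFinOfCardEq (by rw [← Module.finrank_eq_card_basis b₀, hn])
  have hex : ∀ v, ∃ k, v ∈ W k := fun v => ⟨r, hr ▸ Submodule.mem_top⟩
  have hb : ∀ i, b₀.reindex ε i = (ε.symm i : V) := fun i => by simp [b₀]
  refine ⟨b₀.reindex ε, fun i => Nat.find (hex (ε.symm i)), fun i => ?_, fun k v hv i hi => ?_⟩
  · rw [hb]
    exact Nat.find_spec (hex (ε.symm i))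
  · have hk : W k ≤ Submodule.span F (s ∩ W k) := by
      by_cases hkr : k ≤ r
      · exact hspan k hkr
      · have : W k = ⊤ := top_le_iff.1 (hr ▸ hW (not_le.1 hkr).le)
        rw [this, ← hr]
        exact hspan r le_rfl
    have hle : Submodule.span F (s ∩ W k) ≤ LinearMap.ker ((b₀.reindex ε).coord i) := by
      rw [Submodule.span_le]
      rintro x ⟨hxs, hxk⟩
      have hx : x = b₀.reindex ε (ε ⟨x, hxs⟩) := by rw [hb]; simp
      rw [SetLike.mem_coe, LinearMap.mem_ker, Module.Basis.coord_apply]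
      conv_lhs => rw [hx]
      rw [Module.Basis.repr_self, Finsupp.single_eq_of_ne]
      rintro rfl
      exact Nat.find_min _ hi (by simpa using hxk)
    exact hle (hk hv)

end FixedSeries

section Reduction

open IsLocalRing

variable {n : ℕ} {A : Type*} [CommRing A] [IsLocalRing A]

theorem mul_eq_zero_of_mem_maximalIdeal (hm : maximalIdeal A ^ 2 = ⊥) {a b : A}
    (ha : a ∈ maximalIdeal A) (hb : b ∈ maximalIdeal A) : a * b = 0 := by
  have h := Ideal.mul_mem_mul ha hb
  rwa [← pow_two, hm, Ideal.mem_bot] at h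

theorem coe_map_mul_coe_map_eq_zero (hm : maximalIdeal A ^ 2 = ⊥)
    (X Y : Matrix (Fin n) (Fin n) (maximalIdeal A)) :
    X.map Subtype.val * Y.map Subtype.val = 0 := by
  ext i j
  rw [Matrix.mul_apply, Matrix.zero_apply]
  exact Finset.sum_eq_zero fun k _ => mul_eq_zero_of_mem_maximalIdeal hm (X i k).2 (Y k j).2

theorem coe_map_add (X Y : Matrix (Fin n) (Fin n) (maximalIdeal A)) :
    (X + Y).map Subtype.val = X.map Subtype.val + Y.map Subtype.val := by
  ext; simp

/-- The invertible matrix `1 + X`, for `X` with entries in a maximal ideal of square zero. -/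
def oneAddUnit (hm : maximalIdeal A ^ 2 = ⊥) (X : Matrix (Fin n) (Fin n) (maximalIdeal A)) :
    GL (Fin n) A where
  val := 1 + X.map Subtype.val
  inv := 1 - X.map Subtype.val
  val_inv := by
    rw [add_mul, one_mul, mul_sub, mul_one, coe_map_mul_coe_map_eq_zero hm]; abel
  inv_val := by
    rw [sub_mul, one_mul, mul_add, mul_one, coe_map_mul_coe_map_eq_zero hm]; abel

theorem coe_oneAddUnit (hm : maximalIdeal A ^ 2 = ⊥)
    (X : Matrix (Fin n) (Fin n) (maximalIdeal A)) :
    (oneAddUnit hm X : Matrix (Fin n) (Fin n) A) = 1 + X.map Subtype.val := rfl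

theorem oneAddUnit_add (hm : maximalIdeal A ^ 2 = ⊥)
    (X Y : Matrix (Fin n) (Fin n) (maximalIdeal A)) :
    oneAddUnit hm (X + Y) = oneAddUnit hm X * oneAddUnit hm Y := by
  apply Units.ext
  rw [Units.val_mul, coe_oneAddUnit, coe_oneAddUnit, coe_oneAddUnit, coe_map_add, add_mul,
    one_mul, mul_add, mul_one, coe_map_mul_coe_map_eq_zero hm]
  abel

/-- Multiplication by an element `μ` of a maximal ideal of square zero factors through the
residue field. -/
theorem exists_residue_smul (hm : maximalIdeal A ^ 2 = ⊥) (μ : maximalIdeal A) :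
    ∃ t : ResidueField A →+ maximalIdeal A, ∀ a, t (residue A a) = a • μ := by
  have hle : maximalIdeal A ≤ LinearMap.ker (LinearMap.toSpanSingleton A (maximalIdeal A) μ) := by
    intro a ha
    rw [LinearMap.mem_ker, LinearMap.toSpanSingleton_apply]
    exact Subtype.ext (mul_eq_zero_of_mem_maximalIdeal hm ha μ.2)
  exact ⟨(Submodule.liftQ (maximalIdeal A) _ hle).toAddMonoidHom, fun a => rfl⟩

theorem mul_residue_smul_map {μ : maximalIdeal A} {t : ResidueField A →+ maximalIdeal A}
    (ht : ∀ a, t (residue A a) = a • μ) (g : Matrix (Fin n) (Fin n) A)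
    (E : Matrix (Fin n) (Fin n) (ResidueField A)) :
    g * (E.map t).map Subtype.val = (((residue A).mapMatrix g * E).map t).map Subtype.val := by
  ext i j
  simp only [Matrix.mul_apply, Matrix.map_apply, map_sum, AddSubmonoidClass.coe_finsetSum]
  refine Finset.sum_congr rfl fun k _ => ?_
  obtain ⟨a, ha⟩ := residue_surjective (E k j)
  rw [RingHom.mapMatrix_apply, Matrix.map_apply, ← ha, ← map_mul, ht, ht]
  simp [mul_assoc]

theorem residue_smul_map_mul {μ : maximalIdeal A} {t : ResidueField A →+ maximalIdeal A}
    (ht : ∀ a, t (residue A a) = a • μ) (g : Matrix (Fin n) (Fin n) A)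
    (E : Matrix (Fin n) (Fin n) (ResidueField A)) :
    (E.map t).map Subtype.val * g = ((E * (residue A).mapMatrix g).map t).map Subtype.val := by
  ext i j
  simp only [Matrix.mul_apply, Matrix.map_apply, map_sum, AddSubmonoidClass.coe_finsetSum]
  refine Finset.sum_congr rfl fun k _ => ?_
  obtain ⟨a, ha⟩ := residue_surjective (E i k)
  rw [RingHom.mapMatrix_apply, Matrix.map_apply, ← ha, ← map_mul, ht, ht]
  simp only [Submodule.coe_smul, smul_eq_mul]
  ring

/-- A matrix which is invertible modulo the maximal ideal is invertible. -/
theorem exists_unit_of_isUnit_residue (M : Matrix (Fin n) (Fin n) A)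
    (hM : IsUnit ((residue A).mapMatrix M)) : ∃ g : GL (Fin n) A, (g : Matrix _ _ A) = M := by
  rw [Matrix.isUnit_iff_isUnit_det, ← RingHom.map_det] at hM
  have h := (Matrix.isUnit_iff_isUnit_det M).2 (isUnit_of_map_unit _ _ hM)
  exact ⟨h.unit, h.unit_spec⟩

/-- The matrices which are unitriangular with respect to a height function. -/
def unitriangular (A : Type*) [CommRing A] [Finite A] (w : Fin n → ℕ) :
    Subgroup (GL (Fin n) A) :=
  let S : Submonoid (GL (Fin n) A) :=
    { carrier := {g | ∀ i j, ¬ w i < w j → ((g : Matrix _ _ A) - 1) i j = 0}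
      one_mem' := fun i j _ => by simp
      mul_mem' := fun {g h} hg hh i j hij => by
        have e : ((g * h : GL (Fin n) A) : Matrix (Fin n) (Fin n) A) - 1 =
            ((g : Matrix _ _ A) - 1) + ((h : Matrix _ _ A) - 1) +
              ((g : Matrix _ _ A) - 1) * ((h : Matrix _ _ A) - 1) := by
          rw [Units.val_mul]; noncomm_ring
        rw [e, Matrix.add_apply, Matrix.add_apply, hg i j hij, hh i j hij, Matrix.mul_apply,
          zero_add, zero_add]
        refine Finset.sum_eq_zero fun k _ => ?_
        by_cases hik : w i < w k
        · rw [hh k j fun hkj => hij (hik.trans hkj), mul_zero]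
        · rw [hg i k hik, zero_mul] }
  { S with
    inv_mem' := fun {g} hg => by
      have h : g⁻¹ ∈ Submonoid.powers g := by
        rw [(isOfFinOrder_of_finite g).mem_powers_iff_mem_zpowers]
        exact inv_mem (Subgroup.mem_zpowers g)
      exact (Submonoid.powers_le (P := S)).2 hg h }

theorem mem_unitriangular {A : Type*} [CommRing A] [Finite A] {w : Fin n → ℕ} {g : GL (Fin n) A} :
    g ∈ unitriangular A w ↔ ∀ i j, ¬ w i < w j → ((g : Matrix _ _ A) - 1) i j = 0 := Iff.rfl

/-- Conjugation by `g` in the kernel of reduction is conjugation by the residue of `g`. -/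
theorem conj_oneAddUnit (hm : maximalIdeal A ^ 2 = ⊥) {μ : maximalIdeal A}
    {t : ResidueField A →+ maximalIdeal A} (ht : ∀ a, t (residue A a) = a • μ)
    (g : GL (Fin n) A) (E : Matrix (Fin n) (Fin n) (ResidueField A)) :
    g * oneAddUnit hm ((E * (residue A).mapMatrix g).map t) * g⁻¹ =
      oneAddUnit hm (((residue A).mapMatrix g * E).map t) := by
  rw [mul_inv_eq_iff_eq_mul]
  apply Units.ext
  rw [Units.val_mul, Units.val_mul, coe_oneAddUnit, coe_oneAddUnit, mul_add, add_mul, mul_one,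
    one_mul, mul_residue_smul_map ht, residue_smul_map_mul ht, mul_assoc]

/-- The natural representation of a subgroup of `GLₙ(A)` over the residue field. -/
noncomputable def residueRep (P : Subgroup (GL (Fin n) A)) :
    P →* Module.End (ResidueField A) (Fin n → ResidueField A) :=
  (Matrix.toLinAlgEquiv' (R := ResidueField A) (n := Fin n)).toAlgHom.toRingHom.toMonoidHom.comp
    ((residue A).mapMatrix.toMonoidHom.comp ((Units.coeHom _).comp P.subtype))

theorem residueRep_apply (P : Subgroup (GL (Fin n) A)) (g : P) :
    residueRep P g = Matrix.toLin' ((residue A).mapMatrix (g : GL (Fin n) A).val) := rfl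

theorem apply_oneAddUnit_rankOne {Z : Type*} [AddCommGroup Z] (hm : maximalIdeal A ^ 2 = ⊥)
    (P : Subgroup (GL (Fin n) A)) (χ : Matrix (Fin n) (Fin n) (maximalIdeal A) →+ Z)
    (hχ : ∀ g ∈ P, ∀ X Y, g * oneAddUnit hm X * g⁻¹ = oneAddUnit hm Y → χ Y = χ X)
    {μ : maximalIdeal A} {t : ResidueField A →+ maximalIdeal A}
    (ht : ∀ a, t (residue A a) = a • μ) (k : ℕ) {v : Fin n → ResidueField A}
    (hv : v ∈ fixedSeries (residueRep P) k)
    {l : Module.Dual (ResidueField A) (Fin n → ResidueField A)}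
    (hl : l ∈ (fixedSeries (residueRep P) k).dualAnnihilator) :
    χ ((LinearMap.toMatrix' (l.smulRight v)).map t) = 0 := by
  refine apply_smulRight_eq_zero_of_mem_fixedSeries (residueRep P)
    (χ.comp (t.mapMatrix.comp (LinearMap.toMatrix' (R := ResidueField A) (m := Fin n)
      (n := Fin n)).toLinearMap.toAddMonoidHom)) (fun g f => ?_) k hv hl
  refine hχ g g.2 ((LinearMap.toMatrix' (f * residueRep P g)).map t)
    ((LinearMap.toMatrix' (residueRep P g * f)).map t) ?_
  rw [Module.End.mul_eq_comp, Module.End.mul_eq_comp, LinearMap.toMatrix'_comp,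
    LinearMap.toMatrix'_comp, residueRep_apply, LinearMap.toMatrix'_toLin']
  exact conj_oneAddUnit hm ht (g : GL (Fin n) A) _

/-- A character of the kernel of reduction extends to any `p`-subgroup of its stabilizer. -/
theorem exists_extension_to_isPGroup {p : ℕ} [Fact p.Prime] [Finite A]
    (hm : maximalIdeal A ^ 2 = ⊥) (hpF : p ∣ Nat.card (ResidueField A))
    {M : Type*} [CommGroup M] {N P : Subgroup (GL (Fin n) A)} [hNn : N.Normal]
    (hN : ∀ x, x ∈ N ↔ ∀ i j, ((x : Matrix (Fin n) (Fin n) A) - 1) i j ∈ maximalIdeal A)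
    (χ : N →* M) (hNP : N ≤ P) (hP : IsPGroup p P)
    (hstab : ∀ g ∈ P, ∀ (x : GL (Fin n) A) (hx : x ∈ N),
      χ ⟨g * x * g⁻¹, hNn.conj_mem x hx g⟩ = χ ⟨x, hx⟩) :
    ∃ φ : P →* M, ∀ (x : GL (Fin n) A) (hx : x ∈ N), φ ⟨x, hNP hx⟩ = χ ⟨x, hx⟩ := by
  classical
  have hoa : ∀ X, oneAddUnit hm X ∈ N := fun X => by
    rw [hN, coe_oneAddUnit]
    intro i j
    simp
  have hfF : Finite (ResidueField A) := Finite.of_surjective _ residue_surjective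
  let χ₀ : Matrix (Fin n) (Fin n) (maximalIdeal A) →+ Additive M :=
    AddMonoidHom.mk' (fun X => Additive.ofMul (χ ⟨oneAddUnit hm X, hoa X⟩)) fun X Y => by
      rw [← ofMul_mul, ← map_mul]
      exact congrArg (fun x => Additive.ofMul (χ x)) (Subtype.ext (oneAddUnit_add hm X Y))
  have hχ₀ : ∀ g ∈ P, ∀ X Y, g * oneAddUnit hm X * g⁻¹ = oneAddUnit hm Y → χ₀ Y = χ₀ X := by
    intro g hg X Y h
    have h1 := hstab g hg _ (hoa X)
    simp only [h] at h1
    exact congrArg Additive.ofMul h1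
  obtain ⟨r, hr⟩ := exists_fixedSeries_eq_top hpF hP (residueRep P)
  obtain ⟨b, w, hbw, hrepr⟩ := exists_basis_adapted_to_chain (Module.finrank_fin_fun _)
    (fixedSeries (residueRep P)) (fixedSeries_monotone _) rfl hr
  -- a lift `Q` of the adapted basis to `GLₙ(A)`
  obtain ⟨Q, hQ⟩ : ∃ Q : GL (Fin n) A,
      (residue A).mapMatrix Q.val = (Pi.basisFun (ResidueField A) (Fin n)).toMatrix b := by
    let s := Function.surjInv (residue_surjective (R := A))
    have hs : (residue A).mapMatrix (((Pi.basisFun (ResidueField A) (Fin n)).toMatrix b).map s) =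
        (Pi.basisFun (ResidueField A) (Fin n)).toMatrix b := by
      ext i j
      simp [s, Function.surjInv_eq]
    obtain ⟨Q, hQ⟩ := exists_unit_of_isUnit_residue
      (((Pi.basisFun (ResidueField A) (Fin n)).toMatrix b).map s) (by
        rw [hs]
        have := (Pi.basisFun (ResidueField A) (Fin n)).invertibleToMatrix b
        exact isUnit_of_invertible _)
    exact ⟨Q, by rw [hQ, hs]⟩
  have hQinv : (residue A).mapMatrix Q⁻¹.val =
      b.toMatrix (Pi.basisFun (ResidueField A) (Fin n)) := by
    have h1 : (residue A).mapMatrix Q⁻¹.val * (residue A).mapMatrix Q.val = 1 := by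
      rw [← map_mul, ← Units.val_mul, inv_mul_cancel, Units.val_one, map_one]
    have h2 := (Pi.basisFun (ResidueField A) (Fin n)).toMatrix_mul_toMatrix_flip b
    rw [hQ] at h1
    exact left_inv_eq_right_inv h1 h2
  have hconj : ∀ E : Matrix (Fin n) (Fin n) (ResidueField A),
      (residue A).mapMatrix Q⁻¹.val * E * (residue A).mapMatrix Q.val =
        LinearMap.toMatrix b b (Matrix.toLin' E) := by
    intro E
    have hE : LinearMap.toMatrix (Pi.basisFun (ResidueField A) (Fin n))
        (Pi.basisFun (ResidueField A) (Fin n)) (Matrix.toLin' E) = E := by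
      rw [LinearMap.toMatrix_eq_toMatrix', LinearMap.toMatrix'_toLin']
    rw [hQ, hQinv]
    conv_lhs => rw [← hE]
    exact basis_toMatrix_mul_linearMap_toMatrix_mul_basis_toMatrix ..
  have hrank : ∀ i j, LinearMap.toMatrix' ((b.coord j).smulRight (b i)) =
      (residue A).mapMatrix Q.val * Matrix.single i j 1 * (residue A).mapMatrix Q⁻¹.val := by
    intro i j
    ext k l
    rw [hQ, hQinv, LinearMap.toMatrix'_apply, Matrix.mul_apply, Finset.sum_eq_single j]
    · simp [Module.Basis.toMatrix_apply, mul_comm]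
    · intro c _ hc
      simp [Matrix.mul_single_apply_of_ne, hc]
    · simp
  choose t ht using exists_residue_smul hm
  let Φ := Units.map (residue A).mapMatrix.toMonoidHom (M := Matrix (Fin n) (Fin n) A)
  have hNΦ : ∀ x, x ∈ N ↔ Φ x = 1 := by
    intro x
    rw [hN, Units.ext_iff, ← Matrix.ext_iff]
    refine forall₂_congr fun i j => ?_
    rw [← residue_eq_zero_iff, Matrix.sub_apply, map_sub, sub_eq_zero]
    have : residue A ((1 : Matrix (Fin n) (Fin n) A) i j) =
        (1 : Matrix (Fin n) (Fin n) (ResidueField A)) i j := by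
      simp [Matrix.one_apply, apply_ite]
    rw [this]
    rfl
  refine exists_extension_of_trivial_on_inf
    (T := (unitriangular A w).comap (MulAut.conj Q⁻¹).toMonoidHom) χ hNP hstab ?_ ?_
  · intro x hx hxT
    have hy : Q⁻¹ * x * Q⁻¹⁻¹ ∈ N := hNn.conj_mem x hx Q⁻¹
    have hyT : Q⁻¹ * x * Q⁻¹⁻¹ ∈ unitriangular A w := hxT
    rw [inv_inv] at hy hyT
    let Y : Matrix (Fin n) (Fin n) (maximalIdeal A) := fun i j => ⟨_, (hN _).1 hy i j⟩
    have hY : Y.map Subtype.val = (Q⁻¹ * x * Q : GL (Fin n) A).val - 1 := rfl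
    let X : Fin n → Fin n → Matrix (Fin n) (Fin n) (maximalIdeal A) := fun i j =>
      (LinearMap.toMatrix' ((b.coord j).smulRight (b i))).map (t (Y i j))
    have hX : ∀ i j, (X i j).map Subtype.val =
        Q.val * Matrix.single i j (Y i j : A) * Q⁻¹.val := by
      intro i j
      have hs : ((Matrix.single i j (1 : ResidueField A)).map (t (Y i j))).map Subtype.val =
          Matrix.single i j (Y i j : A) := by
        have h1 : t (Y i j) 1 = Y i j := by rw [← map_one (residue A), ht, one_smul]
        rw [Matrix.map_single _ _ _ (t (Y i j)), h1]
        ext k l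
        rw [Matrix.map_apply, Matrix.single_apply, Matrix.single_apply]
        split_ifs <;> rfl
      rw [← hs, mul_residue_smul_map (ht _), residue_smul_map_mul (ht _), ← hrank]
    have hχX : ∀ i j, χ₀ (X i j) = 0 := by
      intro i j
      by_cases hij : w i < w j
      · refine apply_oneAddUnit_rankOne hm P χ₀ hχ₀ (ht _) (w i) (hbw i) ?_
        rw [Submodule.mem_dualAnnihilator]
        exact fun v hv => hrepr _ v hv j hij
      · have h0 : Y i j = 0 := Subtype.ext (hyT i j hij)
        have : X i j = 0 := by
          ext k l
          obtain ⟨a, ha⟩ := residue_surjective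
            (LinearMap.toMatrix' ((b.coord j).smulRight (b i)) k l)
          simp only [X, Matrix.map_apply, ← ha, ht, h0, smul_zero, Matrix.zero_apply]
        rw [this, map_zero]
    have hxX : x = oneAddUnit hm (∑ i, ∑ j, X i j) := by
      apply Units.ext
      have hsum : (∑ i, ∑ j, X i j).map Subtype.val = ∑ i, ∑ j, (X i j).map Subtype.val := by
        ext k l
        simp [Matrix.sum_apply]
      rw [coe_oneAddUnit, hsum]
      simp only [hX, ← Finset.mul_sum, ← Finset.sum_mul]
      have hYs := Matrix.matrix_eq_sum_single (Y.map Subtype.val)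
      simp only [Matrix.map_apply] at hYs
      rw [← hYs, hY, mul_sub, sub_mul, mul_one, ← Units.val_mul, ← Units.val_mul,
        ← Units.val_mul, mul_inv_cancel, Units.val_one, add_sub_cancel]
      congr 1
      group
    have hχx : χ₀ (∑ i, ∑ j, X i j) = 0 := by simp [hχX]
    have : (⟨x, hx⟩ : N) = ⟨_, hoa (∑ i, ∑ j, X i j)⟩ := Subtype.ext hxX
    rw [this]
    exact hχx
  · intro g hg
    have hupper : ∀ i j, ¬ w i < w j →
        (residue A).mapMatrix (Q⁻¹ * g * Q).val i j = (1 : Matrix _ _ (ResidueField A)) i j := by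
      intro i j hij
      rw [Units.val_mul, Units.val_mul, map_mul, map_mul, hconj, LinearMap.toMatrix_apply]
      have hg' := residueRep_apply P ⟨g, hg⟩
      rw [← hg']
      have hj : w j ≠ 0 := fun h0 => b.ne_zero j (by
        have := hbw j
        rwa [h0] at this)
      obtain ⟨k, hk⟩ := Nat.exists_eq_succ_of_ne_zero hj
      have hmem := hbw j
      rw [hk] at hmem
      have h0 := hrepr k _ (mem_fixedSeries_succ.1 hmem ⟨g, hg⟩) i (by lia)
      rw [map_sub, Finsupp.sub_apply, sub_eq_zero] at h0
      rw [h0, Module.Basis.repr_self, Finsupp.single_apply, Matrix.one_apply]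
      simp only [eq_comm]
    let M₀ : Matrix (Fin n) (Fin n) A := Matrix.of fun i j =>
      if w i < w j then (Q⁻¹ * g * Q).val i j else (1 : Matrix (Fin n) (Fin n) A) i j
    have hM₀ : (residue A).mapMatrix M₀ = (residue A).mapMatrix (Q⁻¹ * g * Q).val := by
      ext i j
      by_cases hij : w i < w j
      · exact congrArg (residue A) (if_pos hij)
      · have h1 : M₀ i j = (1 : Matrix (Fin n) (Fin n) A) i j := if_neg hij
        rw [hupper i j hij, RingHom.mapMatrix_apply, Matrix.map_apply, h1]
        simp [Matrix.one_apply, apply_ite]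
    obtain ⟨u, hu⟩ := exists_unit_of_isUnit_residue M₀ (hM₀ ▸ (Φ (Q⁻¹ * g * Q)).isUnit)
    have hΦ : Φ u = Φ (Q⁻¹ * g * Q) := by
      apply Units.ext
      change (residue A).mapMatrix u.val = (residue A).mapMatrix (Q⁻¹ * g * Q).val
      rw [hu, hM₀]
    refine ⟨g * (Q * u * Q⁻¹)⁻¹, ?_, Q * u * Q⁻¹, ?_, (inv_mul_cancel_right _ _).symm⟩
    · rw [hNΦ, map_mul, map_inv, map_mul, map_mul, hΦ, ← map_mul, ← map_mul, ← map_inv,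
        ← map_mul]
      rw [show g * (Q * (Q⁻¹ * g * Q) * Q⁻¹)⁻¹ = 1 by group, map_one]
    · change Q⁻¹ * (Q * u * Q⁻¹) * Q⁻¹⁻¹ ∈ unitriangular A w
      rw [show Q⁻¹ * (Q * u * Q⁻¹) * Q⁻¹⁻¹ = u by group, mem_unitriangular, hu]
      intro i j hij
      rw [Matrix.sub_apply, sub_eq_zero]
      exact if_neg hij

/-- The kernel of reduction has exponent `p`. -/
theorem pow_eq_one_of_mem_kernel (hm : maximalIdeal A ^ 2 = ⊥) {p : ℕ}
    (hpA : (p : A) ∈ maximalIdeal A) {x : GL (Fin n) A}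
    (hx : ∀ i j, ((x : Matrix (Fin n) (Fin n) A) - 1) i j ∈ maximalIdeal A) : x ^ p = 1 := by
  let Y : Matrix (Fin n) (Fin n) (maximalIdeal A) := fun i j => ⟨_, hx i j⟩
  have hxY : x = oneAddUnit hm Y := by
    apply Units.ext
    rw [coe_oneAddUnit]
    exact (add_sub_cancel 1 (x : Matrix (Fin n) (Fin n) A)).symm
  have h0 : oneAddUnit hm (0 : Matrix (Fin n) (Fin n) (maximalIdeal A)) = 1 := by
    have h := oneAddUnit_add hm (0 : Matrix (Fin n) (Fin n) (maximalIdeal A)) 0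
    rwa [add_zero, left_eq_mul] at h
  have hpow : ∀ k : ℕ, oneAddUnit hm Y ^ k = oneAddUnit hm (k • Y) := by
    intro k
    induction k with
    | zero => rw [pow_zero, zero_smul, h0]
    | succ k ih => rw [pow_succ, ih, ← oneAddUnit_add, succ_nsmul]
  have hpY : p • Y = 0 := by
    ext i j
    simpa using mul_eq_zero_of_mem_maximalIdeal hm hpA (Y i j).2
  rw [hxY, hpow, hpY, h0]

/-- A character of the kernel of reduction extends to its stabilizer. -/
theorem exists_extension_to_charStabilizer {p : ℕ} [Fact p.Prime] [Finite A]
    (hm : maximalIdeal A ^ 2 = ⊥) (hpF : p ∣ Nat.card (ResidueField A))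
    (hpA : (p : A) ∈ maximalIdeal A) {K : Type*} [Field K] {N : Subgroup (GL (Fin n) A)}
    [hNn : N.Normal]
    (hN : ∀ x, x ∈ N ↔ ∀ i j, ((x : Matrix (Fin n) (Fin n) A) - 1) i j ∈ maximalIdeal A)
    (χ : N →* Kˣ) (hle : N ≤ charStabilizer N χ) :
    ∃ τ : charStabilizer N χ →* Kˣ,
      ∀ (x : GL (Fin n) A) (hx : x ∈ N), τ ⟨x, hle hx⟩ = χ ⟨x, hx⟩ := by
  set H := charStabilizer N χ
  have hpow : ∀ x ∈ N, x ^ p = 1 := fun x hx => pow_eq_one_of_mem_kernel hm hpA ((hN x).1 hx)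
  have hNp : IsPGroup p (N.subgroupOf H) := fun x =>
    ⟨1, Subtype.ext (Subtype.ext (by simpa using hpow _ x.2))⟩
  obtain ⟨P, hP⟩ := hNp.exists_le_sylow
  have hNP : N ≤ (P : Subgroup H).map H.subtype := fun x hx =>
    ⟨⟨x, hle hx⟩, hP (Subgroup.mem_subgroupOf.2 hx), rfl⟩
  have hstab : ∀ g ∈ H, ∀ (x : GL (Fin n) A) (hx : x ∈ N),
      χ ⟨g * x * g⁻¹, hNn.conj_mem x hx g⟩ = χ ⟨x, hx⟩ := fun g hg => hg
  obtain ⟨φ, hφ⟩ := exists_extension_to_isPGroup hm hpF hN χ hNP (P.isPGroup'.map H.subtype)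
    (fun g hg => hstab g (Subgroup.map_subtype_le _ hg))
  have hval : ∀ (x : H) (hx : x ∈ N.subgroupOf H),
      φ.comp (H.subtype.subgroupMap P) ⟨x, hP hx⟩ = χ ⟨x, hx⟩ := fun x hx => hφ x hx
  have hext := exists_extension_of_coprime_index_s15 hP
    ((Nat.Prime.coprime_iff_not_dvd Fact.out).2 P.not_dvd_index)
    (φ.comp (H.subtype.subgroupMap P)) ?_ ?_
  · obtain ⟨τ, hτ⟩ := hext
    exact ⟨τ, fun x hx => (hτ ⟨x, hle hx⟩ hx).trans (hφ x hx)⟩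
  · intro g x hx hgx
    rw [hval _ hgx, hval _ hx]
    refine Eq.trans ?_ (hstab _ (H.inv_mem g.2) _ hx)
    exact congrArg χ (Subtype.ext (by simp))
  · intro x hx
    rw [hval _ hx, ← map_pow]
    exact (congrArg χ (Subtype.ext (hpow _ hx))).trans (map_one χ)

end Reduction

/-- **Theorem 4.6/Proposition 4.5 for `GLₙ`.** Let `A` be a finite local ring of length
two with residue field of cardinality `q = p ^ d`, `N = ker (GLₙ(A) → GLₙ(A/m))`,
`χ : N → Kˣ` a character with inertia group `H`, and
`e = |N|⁻¹ Σ_{x ∈ N} χ(x)⁻¹ [x] ∈ K[H]`. Then `e` is a central idempotent of `K[H]` and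
the block algebra `e·K[H]` is isomorphic as a `K`-algebra to `K[H/N]`. -/
theorem block_of_inertia_group_iso_group_algebra_of_quotient
    (p d n : ℕ) (hp : p.Prime) (hd : 1 ≤ d) (hn : 1 ≤ n) (q : ℕ) (hq : q = p ^ d)
    (K : Type*) [Field K] [IsAlgClosed K] (hK : ringChar K ≠ p)
    (A : Type*) [CommRing A] [IsLocalRing A] [Fintype A]
    (hm : (IsLocalRing.maximalIdeal A) ^ 2 = ⊥)
    (hres : Nat.card (A ⧸ IsLocalRing.maximalIdeal A) = q)
    (hcard : Nat.card A = q ^ 2)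
    (ρ : GL (Fin n) A →* GL (Fin n) (A ⧸ IsLocalRing.maximalIdeal A))
    (hρ : ρ = Matrix.GeneralLinearGroup.map (Ideal.Quotient.mk (IsLocalRing.maximalIdeal A)))
    (χ : (MonoidHom.ker ρ) →* Kˣ)
    (e : MonoidAlgebra K (charStabilizer (MonoidHom.ker ρ) χ))
    (he : e = (Nat.card (MonoidHom.ker ρ) : K)⁻¹ •
      ∑ᶠ x : (MonoidHom.ker ρ), (((χ x)⁻¹ : Kˣ) : K) •
        MonoidAlgebra.single
          (⟨(x : GL (Fin n) A), ker_le_charStabilizer hm K ρ hρ χ x.2⟩ :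
            charStabilizer (MonoidHom.ker ρ) χ) (1 : K)) :
    ∃ hidem : IsIdempotentElem e,
      (∀ a : MonoidAlgebra K (charStabilizer (MonoidHom.ker ρ) χ), a * e = e * a) ∧
      ∃ f : cornerAlgebra K (MonoidAlgebra K (charStabilizer (MonoidHom.ker ρ) χ)) e →ₙₐ[K]
          MonoidAlgebra K
            ((charStabilizer (MonoidHom.ker ρ) χ) ⧸
              ((MonoidHom.ker ρ).subgroupOf (charStabilizer (MonoidHom.ker ρ) χ))),
        Function.Bijective f ∧ f ⟨e, hidem⟩ = 1 := by
  have hfact : Fact p.Prime := ⟨hp⟩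
  have hcardF : Nat.card (IsLocalRing.ResidueField A) = p ^ d := hres.trans hq
  have hpF : p ∣ Nat.card (IsLocalRing.ResidueField A) :=
    hcardF ▸ dvd_pow_self p (Nat.one_le_iff_ne_zero.1 hd)
  have hfF : Finite (IsLocalRing.ResidueField A) :=
    Finite.of_surjective _ IsLocalRing.residue_surjective
  have hpA : (p : A) ∈ IsLocalRing.maximalIdeal A := by
    have h0 : ((Nat.card (IsLocalRing.ResidueField A) : ℕ) : IsLocalRing.ResidueField A) = 0 := by
      have := Fintype.ofFinite (IsLocalRing.ResidueField A)
      rw [Nat.card_eq_fintype_card, Nat.cast_card_eq_zero]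
    rw [hcardF, Nat.cast_pow] at h0
    rw [← IsLocalRing.residue_eq_zero_iff, map_natCast]
    exact eq_zero_of_pow_eq_zero h0
  have hN : ∀ x, x ∈ MonoidHom.ker ρ ↔
      ∀ i j, ((x : Matrix (Fin n) (Fin n) A) - 1) i j ∈ IsLocalRing.maximalIdeal A := by
    intro x
    subst hρ
    refine ⟨fun hx => entry_sub_one_mem_maximalIdeal x hx, fun hx => ?_⟩
    rw [MonoidHom.mem_ker]
    ext i j
    have h := Ideal.Quotient.eq_zero_iff_mem.2 (hx i j)
    rw [Matrix.sub_apply, map_sub, sub_eq_zero] at h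
    simpa [Matrix.one_apply, apply_ite] using h
  have hle := ker_le_charStabilizer hm K ρ hρ χ
  obtain ⟨τ, hτ⟩ := exists_extension_to_charStabilizer hm hpF hpA hN χ hle
  have := Fintype.ofFinite (MonoidHom.ker ρ)
  have := Fintype.ofFinite ((MonoidHom.ker ρ).subgroupOf (charStabilizer (MonoidHom.ker ρ) χ))
  let ε := Subgroup.subgroupOfEquivOfLe hle
  have hcardN : Nat.card ((MonoidHom.ker ρ).subgroupOf (charStabilizer (MonoidHom.ker ρ) χ)) =
      Nat.card (MonoidHom.ker ρ) := Nat.card_congr ε.toEquiv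
  have hNp : IsPGroup p (MonoidHom.ker ρ) := fun x =>
    ⟨1, Subtype.ext (by simpa using pow_eq_one_of_mem_kernel hm hpA ((hN _).1 x.2))⟩
  have hcardK : (Nat.card (MonoidHom.ker ρ) : K) ≠ 0 := by
    obtain ⟨k, hk⟩ := hNp.exists_card_eq
    rw [hk, Nat.cast_pow]
    refine pow_ne_zero k fun h0 => ?_
    have hdvd := (ringChar.spec K p).1 h0
    rcases (Nat.dvd_prime hp).1 hdvd with h1 | h1
    · exact CharP.ringChar_ne_one h1
    · exact hK h1
  refine exists_corner_iso_quotient (hcardN ▸ hcardK) τ e ?_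
  rw [he, charIdempotent, hcardN, finsum_eq_sum_of_fintype]
  congr 1
  refine Fintype.sum_equiv ε.symm.toEquiv _ _ fun x => ?_
  rw [← hτ x x.2]
  rfl
end
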